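/- There exist ε > 0, η > 0, C > 0 and X₀ > 0 such that the following holds for every integer X ≥ X₀ and every real number α. Let L = ⌊X^{θ+η}⌋ and H = ⌊10·X^{1−γ+η}/γ⌋. Then for all reals M, N, U, V ≥ 1 with X^{7−8γ+8θ+8ε+40η} ≤ M ≤ X^{4γ−3−4θ−4ε−20η}, U ≤ L and V ≤ H, and all complex coefficients a_m (m ∼ M), c_l (l a nonzero integer with |l| ∼ U) and d_h (h a nonzero integer with |h| ∼ V) of modulus at most 1, one has |S₃*| ≤ C·X^{1−2η}, where S₃* = Σ_{m ∼ M} Σ_{n ∼ N, mn ∼ X} Σ_{|l| ∼ U} Σ_{|h| ∼ V} a_m·c_l·d_h·e(α·l·m·n + h·(mn)^γ), the sums running over positive integers m, n and nonzero integers l, h in the indicated ranges. -/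

import Mathlib

open Finset

noncomputable def e (z : ℝ) : ℂ := Complex.exp (2 * Real.pi * Complex.I * z)

noncomputable def nint (x : ℝ) : ℝ := |x - round x|

noncomputable def dyN (Y : ℝ) : Finset ℕ :=
  (Finset.range (⌈Y⌉₊ + 1)).filter fun m => Y/2 ≤ (m:ℝ) ∧ (m:ℝ) < Y

noncomputable def dyZ (Y : ℝ) : Finset ℤ :=
  (Finset.Icc (-(⌈Y⌉₊:ℤ)) (⌈Y⌉₊:ℤ)).filter fun l => l ≠ 0 ∧ Y/2 ≤ |(l:ℝ)| ∧ |(l:ℝ)| < Y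

lemma norm_e (x : ℝ) : ‖e x‖ = 1 := by
  rw [e, show (2 * Real.pi * Complex.I * x : ℂ) = ((2 * Real.pi * x : ℝ) : ℂ) * Complex.I by
    push_cast; ring, Complex.norm_exp_ofReal_mul_I]

lemma e_add (x y : ℝ) : e (x + y) = e x * e y := by
  simp only [e, ← Complex.exp_add]; push_cast; ring_nf

lemma e_int (n : ℤ) : e n = 1 := by
  rw [e, Complex.exp_eq_one_iff]; exact ⟨n, by push_cast; ring⟩

lemma e_neg (x : ℝ) : e (-x) = starRingEnd ℂ (e x) := by
  simp only [e, ← Complex.exp_conj]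
  congr 1
  simp [map_ofNat]

lemma e_zero : e 0 = 1 := by simpa using e_int 0

lemma e_sub (x y : ℝ) : e (x - y) = e x * starRingEnd ℂ (e y) := by
  rw [sub_eq_add_neg, e_add, e_neg]

lemma e_eq_one_iff (x : ℝ) : e x = 1 ↔ ∃ n : ℤ, x = n := by
  refine ⟨fun h => ?_, fun ⟨n, h⟩ => h ▸ e_int n⟩
  rw [e, Complex.exp_eq_one_iff] at h
  obtain ⟨n, hn⟩ := h
  refine ⟨n, ?_⟩
  have h2 : (2 * Real.pi * Complex.I : ℂ) ≠ 0 := Complex.two_pi_I_ne_zero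
  have : (2 * Real.pi * Complex.I : ℂ) * x = (2 * Real.pi * Complex.I : ℂ) * n := by
    rw [hn]; ring
  exact_mod_cast mul_left_cancel₀ h2 this

lemma hasDerivAt_e (x : ℝ) : HasDerivAt e (2 * Real.pi * Complex.I * e x) x := by
  have h1 : HasDerivAt (fun x : ℝ => (2 * Real.pi * Complex.I * x : ℂ))
      (2 * Real.pi * Complex.I) x := by
    simpa using (Complex.ofRealCLM.hasDerivAt (x := x)).const_mul (2 * Real.pi * Complex.I : ℂ)
  have := h1.cexp
  rw [mul_comm]
  exact this

lemma continuous_e : Continuous e :=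
  continuous_iff_continuousAt.2 fun x => (hasDerivAt_e x).continuousAt

lemma norm_sum_e_neg {ι : Type*} (s : Finset ι) (f : ι → ℝ) :
    ‖∑ i ∈ s, e (-f i)‖ = ‖∑ i ∈ s, e (f i)‖ := by
  simp only [e_neg, ← map_sum, RCLike.norm_conj]

lemma norm_sum_e_le {ι : Type*} (s : Finset ι) (f : ι → ℝ) :
    ‖∑ i ∈ s, e (f i)‖ ≤ s.card := by
  refine (norm_sum_le _ _).trans ?_
  simp [norm_e]

/-- Summation by parts for a coefficient sequence of bounded variation. -/
lemma norm_sum_mul_diff_le (g E : ℕ → ℂ) (v : ℕ → ℝ) (hE : ∀ n, ‖E n‖ ≤ 1) (L : ℕ)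
    (hv : ∀ n < L, ‖g (n + 1) - g n‖ ≤ v (n + 1) - v n) :
    ‖∑ n ∈ range (L + 1), g n * (E (n + 1) - E n)‖ ≤ ‖g 0‖ + ‖g L‖ + (v L - v 0) := by
  have key : ∀ k ≤ L, ‖∑ n ∈ range (k + 1), g n * (E (n + 1) - E n) - g k * E (k + 1)‖
      ≤ ‖g 0‖ + (v k - v 0) := by
    intro k
    induction k with
    | zero =>
      intro _
      have : ∑ n ∈ range (0 + 1), g n * (E (n + 1) - E n) - g 0 * E (0 + 1) = - (g 0 * E 0) := by
        simp; ring
      rw [this, norm_neg, norm_mul]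
      have := mul_le_mul_of_nonneg_left (hE 0) (norm_nonneg (g 0))
      linarith
    | succ k ih =>
      intro hk
      have h1 := ih (by omega)
      have h2 := hv k (by omega)
      rw [sum_range_succ]
      have : ∑ n ∈ range (k + 1), g n * (E (n + 1) - E n) + g (k + 1) * (E (k + 1 + 1) - E (k + 1))
          - g (k + 1) * E (k + 1 + 1)
          = (∑ n ∈ range (k + 1), g n * (E (n + 1) - E n) - g k * E (k + 1))
            - (g (k + 1) - g k) * E (k + 1) := by ring
      rw [this]
      refine (norm_sub_le _ _).trans ?_
      have h3 : ‖(g (k + 1) - g k) * E (k + 1)‖ ≤ ‖g (k + 1) - g k‖ := by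
        rw [norm_mul]
        exact mul_le_of_le_one_right (norm_nonneg _) (hE _)
      linarith
  have h1 := key L le_rfl
  have h2 : ‖g L * E (L + 1)‖ ≤ ‖g L‖ := by
    rw [norm_mul]; exact mul_le_of_le_one_right (norm_nonneg _) (hE _)
  have h3 := norm_le_norm_add_norm_sub' (∑ n ∈ range (L + 1), g n * (E (n + 1) - E n))
    (g L * E (L + 1))
  linarith

lemma inv_e_sub_one (u : ℝ) (hu : Real.sin (Real.pi * u) ≠ 0) :
    e u ≠ 1 ∧ (e u - 1)⁻¹ = -(1 / 2) - Complex.I / 2 * (Real.cot (Real.pi * u) : ℝ) := by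
  have hs : (Complex.sin (Real.pi * u)) ≠ 0 := by
    rw [← Complex.ofReal_mul, ← Complex.ofReal_sin]; exact_mod_cast hu
  have h1 : e u - 1 = 2 * Complex.I * Complex.sin (Real.pi * u) *
      Complex.exp (Real.pi * u * Complex.I) := by
    have h2 : e u = Complex.exp (Real.pi * u * Complex.I) * Complex.exp (Real.pi * u * Complex.I) := by
      rw [← Complex.exp_add, e]; ring_nf
    have h3 : Complex.exp (-(Real.pi * u) * Complex.I) * Complex.exp (Real.pi * u * Complex.I) = 1 := by
      rw [← Complex.exp_add]; simp
    rw [h2, Complex.sin]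
    linear_combination -Complex.I ^ 2 * h3 +
      (Complex.exp (Real.pi * u * Complex.I) ^ 2 - 1) * Complex.I_sq
  have h4 : e u - 1 ≠ 0 := by
    rw [h1]
    exact mul_ne_zero (mul_ne_zero (by simp) hs) (Complex.exp_ne_zero _)
  refine ⟨sub_ne_zero.1 h4, inv_eq_of_mul_eq_one_right ?_⟩
  rw [h1, Complex.ofReal_cot, Complex.cot_eq_cos_div_sin, Complex.ofReal_mul, Complex.exp_mul_I]
  field_simp
  have := Complex.sin_sq_add_cos_sq (Real.pi * u)
  linear_combination this - (Complex.cos (Real.pi * u) ^ 2 + Complex.sin (Real.pi * u) ^ 2 +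
    Complex.I * Complex.cos (Real.pi * u) * Complex.sin (Real.pi * u)) * Complex.I_sq

lemma two_mul_le_sin {δ u : ℝ} (h0 : 0 ≤ δ) (h1 : δ ≤ u) (h2 : u ≤ 1 - δ) :
    2 * δ ≤ Real.sin (Real.pi * u) := by
  have hpi := Real.pi_pos
  rcases le_total u (1 / 2) with h | h
  · have := Real.mul_le_sin (x := Real.pi * u) (by positivity [h0.trans h1]) (by nlinarith)
    have h3 : 2 / Real.pi * (Real.pi * u) = 2 * u := by field_simp
    linarith
  · have := Real.mul_le_sin (x := Real.pi * (1 - u)) (by nlinarith) (by nlinarith)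
    have h3 : 2 / Real.pi * (Real.pi * (1 - u)) = 2 * (1 - u) := by field_simp
    rw [mul_sub, mul_one, Real.sin_pi_sub] at this
    linarith

lemma cot_anti {a b : ℝ} (ha : 0 < a) (hab : a ≤ b) (hb : b < 1) :
    Real.cot (Real.pi * b) ≤ Real.cot (Real.pi * a) := by
  have hpi := Real.pi_pos
  have h1 : 0 < Real.sin (Real.pi * a) := Real.sin_pos_of_pos_of_lt_pi (by positivity) (by nlinarith)
  have h2 : 0 < Real.sin (Real.pi * b) := Real.sin_pos_of_pos_of_lt_pi (by nlinarith) (by nlinarith)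
  rw [Real.cot_eq_cos_div_sin, Real.cot_eq_cos_div_sin, div_le_div_iff₀ h2 h1]
  have h3 : 0 ≤ Real.sin (Real.pi * b - Real.pi * a) :=
    Real.sin_nonneg_of_nonneg_of_le_pi (by nlinarith) (by nlinarith)
  rw [Real.sin_sub] at h3
  linarith

/-- The Kusmin–Landau inequality for a sequence with monotone differences. -/
lemma kusmin_landau (F : ℕ → ℝ) (L : ℕ) (k : ℤ) {δ : ℝ} (hδ : 0 < δ)
    (hmono : ∀ n, n + 1 < L → F (n + 1) - F n ≤ F (n + 2) - F (n + 1))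
    (h1 : ∀ n < L, k + δ ≤ F (n + 1) - F n) (h2 : ∀ n < L, F (n + 1) - F n ≤ k + 1 - δ) :
    ‖∑ n ∈ range L, e (F n)‖ ≤ 1 / δ := by
  obtain _ | L := L
  · simp; positivity
  set u : ℕ → ℝ := fun n => F (n + 1) - F n - k with hu
  have hu1 : ∀ n < L + 1, δ ≤ u n := fun n hn => by have := h1 n hn; simp only [hu]; linarith
  have hu2 : ∀ n < L + 1, u n ≤ 1 - δ := fun n hn => by have := h2 n hn; simp only [hu]; linarith
  have hsin : ∀ n < L + 1, 2 * δ ≤ Real.sin (Real.pi * u n) := fun n hn =>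
    two_mul_le_sin hδ.le (hu1 n hn) (hu2 n hn)
  set g : ℕ → ℂ := fun n => (e (u n) - 1)⁻¹ with hg
  have hgn : ∀ n < L + 1, g n = -(1 / 2) - Complex.I / 2 * (Real.cot (Real.pi * u n) : ℝ) :=
    fun n hn => (inv_e_sub_one (u n) (by have := hsin n hn; linarith)).2
  set E : ℕ → ℂ := fun n => e (F n - k * n) with hE
  have hEe : ∀ n, E n = e (F n) := fun n => by
    have := e_int (k * n)
    push_cast at this
    simp only [hE]
    rw [e_sub, this]; simp
  have hsum : ∑ n ∈ range (L + 1), e (F n) = ∑ n ∈ range (L + 1), g n * (E (n + 1) - E n) := by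
    refine sum_congr rfl fun n hn => ?_
    have hn := mem_range.1 hn
    have h3 := (inv_e_sub_one (u n) (by have := hsin n hn; linarith)).1
    have h4 : E (n + 1) = E n * e (u n) := by
      simp only [hE, hu, ← e_add]; push_cast; ring_nf
    rw [h4, hg, ← hEe n]
    have : e (u n) - 1 ≠ 0 := sub_ne_zero.2 h3
    field_simp
  have hcotb : ∀ n < L + 1, |Real.cot (Real.pi * u n)| ≤ 1 / (2 * δ) := fun n hn => by
    rw [Real.cot_eq_cos_div_sin, abs_div]
    have h5 := hsin n hn
    refine div_le_div₀ zero_le_one (Real.abs_cos_le_one _) (by positivity) (h5.trans (le_abs_self _))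
  have hnorm : ∀ n < L + 1, ‖g n‖ ≤ 1 / (4 * δ) := fun n hn => by
    have h5 := hsin n hn
    rw [hg]
    simp only [norm_inv]
    rw [← one_div]
    refine one_div_le_one_div_of_le (by positivity) ?_
    have h6 : e (u n) - 1 = e (u n / 2) * (2 * Complex.I * Real.sin (Real.pi * u n)) := by
      have h7 : e (u n) = e (u n / 2) * e (u n / 2) := by rw [← e_add]; ring_nf
      have h8 : e (-(u n / 2)) * e (u n / 2) = 1 := by rw [← e_add]; simp [e_zero]
      have h9 : (Real.sin (Real.pi * u n) : ℂ) = (e (-(u n / 2)) - e (u n / 2)) * Complex.I / 2 := by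
        rw [Complex.ofReal_sin, Complex.sin, e, e]; push_cast; ring_nf
      rw [h9, h7]
      linear_combination -Complex.I ^ 2 * h8 + (e (u n / 2) ^ 2 - 1) * Complex.I_sq
    rw [h6, norm_mul, norm_e, norm_mul]
    simp only [norm_mul, Complex.norm_I, Complex.norm_real, Real.norm_eq_abs]
    have := h5.trans (le_abs_self _)
    norm_num
    linarith
  rw [hsum]
  refine (norm_sum_mul_diff_le g E (fun n => -(Real.cot (Real.pi * u n)) / 2)
    (fun n => (norm_e _).le) L ?_).trans ?_
  · intro n hn
    rw [hgn n (by omega), hgn (n + 1) (by omega)]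
    have h3 : u n ≤ u (n + 1) := by
      have := hmono n (by omega); simp only [hu]; linarith
    have h4 := cot_anti (hδ.trans_le (hu1 n (by omega))) h3 (by have := hu2 (n+1) (by omega); linarith)
    have h5 : -(1 / 2 : ℂ) - Complex.I / 2 * (Real.cot (Real.pi * u (n + 1)) : ℝ) -
      (-(1 / 2) - Complex.I / 2 * (Real.cot (Real.pi * u n) : ℝ)) =
      Complex.I * (((Real.cot (Real.pi * u n) - Real.cot (Real.pi * u (n + 1))) / 2 : ℝ) : ℂ) := by
      push_cast; ring
    rw [h5, norm_mul, Complex.norm_I, Complex.norm_real, Real.norm_eq_abs, abs_of_nonneg (by linarith)]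
    linarith
  · have a1 := hnorm 0 (by omega)
    have a2 := hnorm L (by omega)
    have a3 := abs_le.1 (hcotb 0 (by omega))
    have a4 := abs_le.1 (hcotb L (by omega))
    have : 1 / δ = 1 / (4 * δ) + 1 / (4 * δ) + 1 / (2 * δ) := by field_simp; norm_num
    linarith

lemma exists_filter_eq_Ico (D : ℕ → ℝ) (L : ℕ)
    (hD : ∀ i j, i ≤ j → j < L → D i ≤ D j) (y z : ℝ) :
    ∃ a b, a ≤ b ∧ b ≤ L ∧ (range L).filter (fun n => y ≤ D n ∧ D n < z) = Ico a b := by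
  have key : ∀ w : ℝ, ∃ p ≤ L, ∀ n < L, D n < w ↔ n < p := by
    intro w
    by_cases h : ∃ n, n < L ∧ w ≤ D n
    · classical
      refine ⟨Nat.find h, (Nat.find_spec h).1.le, fun n hn => ⟨fun hw => ?_, fun hw => ?_⟩⟩
      · by_contra hc
        have := hD _ _ (not_lt.1 hc) hn
        linarith [(Nat.find_spec h).2]
      · have := Nat.find_min h hw
        push Not at this
        exact this hn
    · push Not at h
      exact ⟨L, le_rfl, fun n hn => ⟨fun _ => hn, fun _ => h n hn⟩⟩
  obtain ⟨p, hp, hp'⟩ := key y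
  obtain ⟨q, hq, hq'⟩ := key z
  refine ⟨p, max p q, le_max_left _ _, max_le hp hq, ?_⟩
  ext n
  simp only [mem_filter, mem_range, mem_Ico, lt_max_iff]
  constructor
  · rintro ⟨hn, h1, h2⟩
    have := (hp' n hn).not.1 (not_lt.2 h1)
    exact ⟨not_lt.1 this, Or.inr ((hq' n hn).1 h2)⟩
  · rintro ⟨h1, h2⟩
    have hq2 : n < q := by omega
    have hn : n < L := by omega
    exact ⟨hn, not_lt.1 ((hp' n hn).not.2 (not_lt.2 h1)), (hq' n hn).2 hq2⟩

/-- Van der Corput's second derivative test, for sequences. -/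
lemma van_der_corput (F : ℕ → ℝ) (L : ℕ) {l u : ℝ} (hl : 0 < l)
    (h1 : ∀ n < L, l ≤ F (n + 2) - 2 * F (n + 1) + F n)
    (h2 : ∀ n < L, F (n + 2) - 2 * F (n + 1) + F n ≤ u) :
    ‖∑ n ∈ range L, e (F n)‖ ≤ 6 * (L * u + 2) / √l := by
  obtain rfl | hL := Nat.eq_zero_or_pos L
  · simp; positivity
  have hlu : l ≤ u := (h1 0 hL).trans (h2 0 hL)
  have hu : 0 < u := hl.trans_le hlu
  set δ := √l with hδ
  have hδ0 : 0 < δ := Real.sqrt_pos.2 hl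
  have hδ2 : δ * δ = l := Real.mul_self_sqrt hl.le
  rcases le_or_gt δ (1 / 2) with hs | hs
  swap
  · refine (norm_sum_e_le _ _).trans ?_
    rw [card_range, le_div_iff₀ hδ0]
    have : (L : ℝ) * δ ≤ L * (2 * u) := mul_le_mul_of_nonneg_left (by nlinarith) (by positivity)
    have : 0 ≤ (L : ℝ) * u := by positivity
    nlinarith
  set D : ℕ → ℝ := fun n => F (n + 1) - F n with hDdef
  have hstep : ∀ n < L, l ≤ D (n + 1) - D n ∧ D (n + 1) - D n ≤ u := fun n hn => by
    have a := h1 n hn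
    have b := h2 n hn
    simp only [hDdef]
    constructor <;> linarith
  have hlow : ∀ i k, i + k ≤ L → l * k ≤ D (i + k) - D i := by
    intro i k
    induction k with
    | zero => simp
    | succ k ih =>
      intro hk
      have := ih (by omega)
      have := (hstep (i + k) (by omega)).1
      rw [← add_assoc]; push_cast; linarith
  have hup : ∀ k ≤ L, D k - D 0 ≤ u * k := by
    intro k
    induction k with
    | zero => simp
    | succ k ih =>
      intro hk
      have := ih (by omega)
      have := (hstep k (by omega)).2
      push_cast; linarith
  have hmono : ∀ i j, i ≤ j → j < L → D i ≤ D j := fun i j hij hj => by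
    have := hlow i (j - i) (by omega)
    rw [show i + (j - i) = j by omega] at this
    have : 0 ≤ l * (j - i : ℕ) := by positivity
    linarith
  have hcard : ∀ y z : ℝ, y ≤ z →
      ((((range L).filter (fun n => y ≤ D n ∧ D n < z)).card : ℕ) : ℝ) ≤ (z - y) / l + 1 := by
    intro y z hyz
    obtain ⟨a, b, hab, hb, h⟩ := exists_filter_eq_Ico D L hmono y z
    rw [h, Nat.card_Ico]
    rcases hab.eq_or_lt with rfl | hlt
    · simp; have : 0 ≤ (z - y) / l := div_nonneg (by linarith) hl.le
      linarith
    · have ha : a ∈ Ico a b := by simp [hlt]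
      have hb' : b - 1 ∈ Ico a b := by simp; omega
      rw [← h, mem_filter] at ha hb'
      have h3 := hlow a (b - 1 - a) (by omega)
      rw [show a + (b - 1 - a) = b - 1 by omega] at h3
      have h4 : ((b - a : ℕ) : ℝ) = ((b - 1 - a : ℕ) : ℝ) + 1 := by
        rw [show b - a = b - 1 - a + 1 by omega]; push_cast; ring
      rw [h4]
      have : ((b - 1 - a : ℕ) : ℝ) ≤ (z - y) / l := by
        rw [le_div_iff₀ hl]
        linarith [ha.2.1, hb'.2.2]
      linarith
  have hpiece : ∀ k : ℤ, ‖∑ n ∈ (range L).filter (fun n => ⌊D n⌋ = k), e (F n)‖ ≤ 6 / δ := by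
    intro k
    have hfl : (range L).filter (fun n => ⌊D n⌋ = k) =
        (range L).filter (fun n => (k : ℝ) ≤ D n ∧ D n < k + δ) ∪
        ((range L).filter (fun n => (k + δ : ℝ) ≤ D n ∧ D n < k + 1 - δ) ∪
        (range L).filter (fun n => (k + 1 - δ : ℝ) ≤ D n ∧ D n < k + 1)) := by
      ext n
      simp only [mem_filter, mem_union, Int.floor_eq_iff, ← and_or_left]
      refine and_congr_right fun _ => ?_
      constructor
      · rintro ⟨a, b⟩
        rcases lt_or_ge (D n) (k + δ) with c | c
        · exact Or.inl ⟨a, c⟩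
        · rcases lt_or_ge (D n) (k + 1 - δ) with d | d
          · exact Or.inr (Or.inl ⟨c, d⟩)
          · exact Or.inr (Or.inr ⟨d, b⟩)
      · rintro (⟨a, b⟩ | ⟨a, b⟩ | ⟨a, b⟩) <;> constructor <;> linarith
    have hdis1 : Disjoint ((range L).filter (fun n => (k + δ : ℝ) ≤ D n ∧ D n < k + 1 - δ))
        ((range L).filter (fun n => (k + 1 - δ : ℝ) ≤ D n ∧ D n < k + 1)) := by
      rw [disjoint_filter]; rintro n - ⟨_, a⟩ ⟨b, _⟩; linarith
    have hdis2 : Disjoint ((range L).filter (fun n => (k : ℝ) ≤ D n ∧ D n < k + δ))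
        ((range L).filter (fun n => (k + δ : ℝ) ≤ D n ∧ D n < k + 1 - δ) ∪
        (range L).filter (fun n => (k + 1 - δ : ℝ) ≤ D n ∧ D n < k + 1)) := by
      rw [disjoint_union_right]
      constructor <;> rw [disjoint_filter] <;> rintro n - ⟨_, a⟩ ⟨b, _⟩ <;> linarith
    rw [hfl, sum_union hdis2, sum_union hdis1]
    have hδl : δ / l + 1 ≤ 3 / 2 / δ := by
      rw [← hδ2]
      have : δ / (δ * δ) = 1 / δ := by field_simp
      rw [this, div_add_one hδ0.ne']
      gcongr; linarith
    have e1 : ‖∑ n ∈ (range L).filter (fun n => (k : ℝ) ≤ D n ∧ D n < k + δ), e (F n)‖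
        ≤ 3 / 2 / δ := by
      refine (norm_sum_e_le _ _).trans ((hcard _ _ (by linarith)).trans ?_)
      rw [add_sub_cancel_left]; exact hδl
    have e3 : ‖∑ n ∈ (range L).filter (fun n => (k + 1 - δ : ℝ) ≤ D n ∧ D n < k + 1), e (F n)‖
        ≤ 3 / 2 / δ := by
      refine (norm_sum_e_le _ _).trans ((hcard _ _ (by linarith)).trans ?_)
      rw [sub_sub_cancel]; exact hδl
    have e2 : ‖∑ n ∈ (range L).filter (fun n => (k + δ : ℝ) ≤ D n ∧ D n < k + 1 - δ), e (F n)‖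
        ≤ 1 / δ := by
      obtain ⟨a, b, hab, hb, h⟩ := exists_filter_eq_Ico D L hmono (k + δ) (k + 1 - δ)
      rw [h, sum_Ico_eq_sum_range]
      have hmem : ∀ n < b - a, (k + δ : ℝ) ≤ D (a + n) ∧ D (a + n) < k + 1 - δ := fun n hn => by
        have : a + n ∈ Ico a b := by simp; omega
        rw [← h, mem_filter] at this
        exact this.2
      refine kusmin_landau (fun n => F (a + n)) (b - a) k hδ0 ?_ ?_ ?_
      · intro n hn
        have := hmono (a + n) (a + (n + 1)) (by omega) (by omega)
        simp only [hDdef] at this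
        exact this
      · exact fun n hn => (hmem n hn).1
      · exact fun n hn => (hmem n hn).2.le
    refine (norm_add_le _ _).trans ?_
    have := norm_add_le (∑ n ∈ (range L).filter (fun n => (k + δ : ℝ) ≤ D n ∧ D n < k + 1 - δ), e (F n))
      (∑ n ∈ (range L).filter (fun n => (k + 1 - δ : ℝ) ≤ D n ∧ D n < k + 1), e (F n))
    have h6 : 6 / δ = 3 / 2 / δ + 1 / δ + 3 / 2 / δ + 2 / δ := by field_simp; norm_num
    have : 0 < 2 / δ := by positivity
    linarith
  have hfib : ∑ n ∈ range L, e (F n) = ∑ k ∈ Icc ⌊D 0⌋ ⌊D (L - 1)⌋,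
      ∑ n ∈ (range L).filter (fun n => ⌊D n⌋ = k), e (F n) := by
    refine (sum_fiberwise_of_maps_to (fun n hn => ?_) _).symm
    have hn := mem_range.1 hn
    rw [mem_Icc]
    exact ⟨Int.floor_le_floor (hmono _ _ (by omega) hn),
      Int.floor_le_floor (hmono _ _ (by omega) (by omega))⟩
  rw [hfib]
  refine (norm_sum_le _ _).trans ((sum_le_sum fun k _ => hpiece k).trans ?_)
  rw [sum_const, nsmul_eq_mul, Int.card_Icc]
  have hfl : ⌊D 0⌋ ≤ ⌊D (L - 1)⌋ := Int.floor_le_floor (hmono _ _ (by omega) (by omega))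
  have hc : ((⌊D (L - 1)⌋ + 1 - ⌊D 0⌋).toNat : ℝ) ≤ L * u + 2 := by
    have h3 : (((⌊D (L - 1)⌋ + 1 - ⌊D 0⌋).toNat : ℤ) : ℝ) = ((⌊D (L - 1)⌋ + 1 - ⌊D 0⌋ : ℤ) : ℝ) := by
      rw [Int.toNat_of_nonneg (by omega)]
    rw [Int.cast_natCast] at h3
    rw [h3]
    push_cast
    have h4 := Int.floor_le (D (L - 1))
    have h5 := Int.lt_floor_add_one (D 0)
    have h6 := hup (L - 1) (by omega)
    have h7 : ((L - 1 : ℕ) : ℝ) ≤ L := by exact_mod_cast Nat.sub_le _ _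
    nlinarith
  calc _ ≤ (L * u + 2) * (6 / δ) := by gcongr
    _ = _ := by ring

/-- A version of the second derivative test in which the hypotheses only concern terms
inside the range of summation. -/
lemma van_der_corput_inside (F : ℕ → ℝ) (L : ℕ) {l u : ℝ} (hl : 0 < l) (hlu : l ≤ u)
    (h1 : ∀ n, n + 2 < L → l ≤ F (n + 2) - 2 * F (n + 1) + F n)
    (h2 : ∀ n, n + 2 < L → F (n + 2) - 2 * F (n + 1) + F n ≤ u) :
    ‖∑ n ∈ range L, e (F n)‖ ≤ 8 * (L * u + 2) / √l := by
  obtain rfl | hL := Nat.eq_zero_or_pos L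
  · simp; positivity
  have hu : 0 < u := hl.trans_le hlu
  have hs : 0 < √l := Real.sqrt_pos.2 hl
  have hs2 : √l * √l = l := Real.mul_self_sqrt hl.le
  have hL1 : (1 : ℝ) ≤ L := by exact_mod_cast hL
  have h0 : 2 ≤ 2 * (L * u + 2) / √l := by
    rw [le_div_iff₀ hs]
    nlinarith [sq_nonneg (√l - 1)]
  have hsplit : 8 * (L * u + 2) / √l = 6 * (L * u + 2) / √l + 2 * (L * u + 2) / √l := by ring
  rcases le_or_gt L 2 with h | h
  · refine (norm_sum_e_le _ _).trans ?_
    rw [card_range]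
    have : (L : ℝ) ≤ 2 := by exact_mod_cast h
    have : 0 ≤ 6 * (L * u + 2) / √l := by positivity
    linarith
  · obtain ⟨K, rfl⟩ : ∃ K, L = K + 2 := ⟨L - 2, by omega⟩
    rw [sum_range_succ, sum_range_succ, add_assoc]
    have h3 := van_der_corput F K hl (fun n hn => h1 n (by omega)) (fun n hn => h2 n (by omega))
    have h4 : 6 * (K * u + 2) / √l ≤ 6 * ((K + 2 : ℕ) * u + 2) / √l := by
      gcongr; linarith
    rw [hsplit]
    refine (norm_add_le _ _).trans (add_le_add (h3.trans h4) ?_)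
    refine (norm_add_le _ _).trans ?_
    rw [norm_e, norm_e]; linarith

/-- The function `u ↦ u / (e u - 1)` extends to a Lipschitz function on `[-3/4, 3/4]`. -/
lemma exists_lipschitz_quotient : ∃ (κ : ℝ → ℂ) (C : ℝ), 0 ≤ C ∧
    (∀ u : ℝ, |u| ≤ 3 / 4 → (u : ℂ) = κ u * (e u - 1)) ∧
    (∀ u : ℝ, |u| ≤ 3 / 4 → ‖κ u‖ ≤ C) ∧
    (∀ u v : ℝ, |u| ≤ 3 / 4 → |v| ≤ 3 / 4 → ‖κ u - κ v‖ ≤ C * |u - v|) := by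
  set g : ℂ → ℂ := dslope Complex.exp 0 with hg
  have hgd : Differentiable ℂ g := by
    have := (Complex.differentiableOn_dslope (f := Complex.exp) (c := 0) (s := Set.univ)
      Filter.univ_mem).2 Complex.differentiable_exp.differentiableOn
    exact differentiableOn_univ.1 this
  have hgz : ∀ z : ℂ, z * g z = Complex.exp z - 1 := by
    intro z
    have := sub_smul_dslope Complex.exp 0 z
    simpa using this
  set G : ℝ → ℂ := fun u => g (2 * Real.pi * Complex.I * u) with hG
  set κ : ℝ → ℂ := fun u => (2 * Real.pi * Complex.I * G u)⁻¹ with hκ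
  have hGne : ∀ u : ℝ, |u| ≤ 3 / 4 → G u ≠ 0 := by
    intro u hu h0
    have h1 := hgz (2 * Real.pi * Complex.I * u)
    have h2 : g (2 * Real.pi * Complex.I * u) = 0 := h0
    rw [h2, mul_zero] at h1
    have h3 : e u = 1 := (sub_eq_zero.1 h1.symm)
    obtain ⟨n, hn⟩ := (e_eq_one_iff u).1 h3
    have hn0 : n = 0 := by
      rw [hn] at hu
      have : |(n : ℝ)| < 1 := by linarith
      rw [← Int.cast_abs] at this
      exact Int.abs_lt_one_iff.1 (by exact_mod_cast this)
    rw [hn, hn0] at h2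
    simp [hg] at h2
  have hden : ∀ u : ℝ, |u| ≤ 3 / 4 → (2 * Real.pi * Complex.I * G u) ≠ 0 := fun u hu =>
    mul_ne_zero Complex.two_pi_I_ne_zero (hGne u hu)
  have hGsm : ContDiff ℝ 1 G := by
    have h1 : ContDiff ℂ 1 g := hgd.contDiff
    have h2 : ContDiff ℝ 1 (fun u : ℝ => (2 * Real.pi * Complex.I * u : ℂ)) :=
      contDiff_const.mul Complex.ofRealCLM.contDiff
    exact (h1.restrict_scalars ℝ).comp h2
  have hκsm : ∀ u ∈ Set.Icc (-(3 / 4) : ℝ) (3 / 4), ContDiffAt ℝ 1 κ u := by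
    intro u hu
    exact (contDiffAt_const.mul hGsm.contDiffAt).inv (hden u (abs_le.2 hu))
  obtain ⟨K, hK⟩ := ContDiffOn.exists_lipschitzOnWith (n := 1)
    (fun u hu => (hκsm u hu).contDiffWithinAt) one_ne_zero (convex_Icc _ _) isCompact_Icc
  obtain ⟨B, hB⟩ := isCompact_Icc.exists_bound_of_continuousOn
    (fun u hu => (hκsm u hu).continuousAt.continuousWithinAt)
  have hmem : ∀ u : ℝ, |u| ≤ 3 / 4 → u ∈ Set.Icc (-(3 / 4) : ℝ) (3 / 4) := fun u hu => abs_le.1 hu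
  refine ⟨κ, max B K, le_max_of_le_right K.2, fun u hu => ?_, fun u hu => ?_, fun u v hu hv => ?_⟩
  · have h1 := hgz (2 * Real.pi * Complex.I * u)
    have h2 : e u - 1 = (2 * Real.pi * Complex.I * G u) * u := by
      simp only [e, ← h1, hG]; ring
    rw [h2, ← mul_assoc, inv_mul_cancel₀ (hden u hu), one_mul]
  · exact (hB u (hmem u hu)).trans (le_max_left _ _)
  · have := hK.dist_le_mul u (hmem u hu) v (hmem v hv)
    rw [dist_eq_norm, Real.dist_eq] at this
    exact this.trans (mul_le_mul_of_nonneg_right (le_max_right _ _) (abs_nonneg _))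

lemma exists_norm_sum_deriv_mul_e_le : ∃ C : ℝ, 0 ≤ C ∧ ∀ (F D : ℕ → ℝ) (K : ℕ),
    (∀ m < K, D (m + 1) ≤ F (m + 1) - F m ∧ F (m + 1) - F m ≤ D m) →
    (∀ m ≤ K, |D m| ≤ 3 / 4) → ‖∑ m ∈ range (K + 1), (D m : ℂ) * e (F m)‖ ≤ C := by
  obtain ⟨κ, C, hC, hκ, hκb, hκl⟩ := exists_lipschitz_quotient
  refine ⟨4 * C + 3, by positivity, fun F D K hD hb => ?_⟩
  have hb' : ∀ m ≤ K, -(3 / 4) ≤ D m ∧ D m ≤ 3 / 4 := fun m hm => abs_le.1 (hb m hm)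
  set Δ : ℕ → ℝ := fun m => F (m + 1) - F m with hΔ
  have hΔb : ∀ m < K, |Δ m| ≤ 3 / 4 := fun m hm =>
    abs_le.2 ⟨(hb' (m + 1) hm).1.trans (hD m hm).1, (hD m hm).2.trans (hb' m hm.le).2⟩
  have h1 : ‖∑ m ∈ range K, (Δ m : ℂ) * e (F m)‖ ≤ 4 * C := by
    obtain rfl | ⟨L, rfl⟩ : K = 0 ∨ ∃ L, K = L + 1 := by
      cases K <;> simp
    · simpa using hC
    have h2 : ∑ m ∈ range (L + 1), (Δ m : ℂ) * e (F m) =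
        ∑ m ∈ range (L + 1), κ (Δ m) * (e (F (m + 1)) - e (F m)) := by
      refine sum_congr rfl fun m hm => ?_
      have h3 : F (m + 1) = Δ m + F m := by simp [hΔ]
      rw [h3, e_add]
      have := hκ (Δ m) (hΔb m (mem_range.1 hm))
      linear_combination e (F m) * this
    rw [h2]
    refine (norm_sum_mul_diff_le (fun m => κ (Δ m)) (fun m => e (F m)) (fun m => -(C * Δ m))
      (fun n => (norm_e _).le) L fun n hn => ?_).trans ?_
    · refine (hκl _ _ (hΔb _ (by omega)) (hΔb _ (by omega))).trans ?_
      have : Δ (n + 1) ≤ Δ n := (hD (n + 1) (by omega)).2.trans (hD n (by omega)).1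
      rw [abs_of_nonpos (by linarith)]
      linarith
    · have a := hκb _ (hΔb 0 (by omega))
      have b := hκb _ (hΔb L (by omega))
      have c := abs_le.1 (hΔb 0 (by omega))
      have d := abs_le.1 (hΔb L (by omega))
      nlinarith
  have h2 : ‖∑ m ∈ range K, ((D m - Δ m : ℝ) : ℂ) * e (F m)‖ ≤ 3 / 2 := by
    refine (norm_sum_le _ _).trans ?_
    calc ∑ m ∈ range K, ‖((D m - Δ m : ℝ) : ℂ) * e (F m)‖ ≤ ∑ m ∈ range K, (D m - D (m + 1)) := by
          refine sum_le_sum fun m hm => ?_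
          have := hD m (mem_range.1 hm)
          rw [norm_mul, norm_e, mul_one, Complex.norm_real, Real.norm_eq_abs,
            abs_of_nonneg (by simp only [hΔ]; linarith)]
          simp only [hΔ]; linarith
      _ ≤ 3 / 2 := by
          rw [sum_range_sub']
          linarith [hb' 0 (by omega), hb' K le_rfl]
  have h3 : ‖(D K : ℂ) * e (F K)‖ ≤ 3 / 4 := by
    rw [norm_mul, norm_e, mul_one, Complex.norm_real]; exact hb K le_rfl
  have h4 : ∑ m ∈ range (K + 1), (D m : ℂ) * e (F m) = ∑ m ∈ range K, (Δ m : ℂ) * e (F m) +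
      ∑ m ∈ range K, ((D m - Δ m : ℝ) : ℂ) * e (F m) + (D K : ℂ) * e (F K) := by
    rw [sum_range_succ, ← sum_add_distrib]
    congr 1
    refine sum_congr rfl fun m _ => ?_
    push_cast; ring
  rw [h4]
  refine (norm_add₃_le).trans ?_
  linarith

lemma exists_sum_sub_integral_le_of_nat : ∃ C : ℝ, 0 ≤ C ∧ ∀ (f f' : ℝ → ℝ) (p K : ℕ),
    (∀ x ∈ Set.Icc (p : ℝ) (p + K), HasDerivAt f (f' x) x) →
    AntitoneOn f' (Set.Icc (p : ℝ) (p + K)) → (∀ x ∈ Set.Icc (p : ℝ) (p + K), |f' x| ≤ 3 / 4) →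
    ‖∑ m ∈ range K, e (f (p + m)) - ∫ x in (p : ℝ)..(p + K), e (f x)‖ ≤ C := by
  obtain ⟨C, hC, hmain⟩ := exists_norm_sum_deriv_mul_e_le
  refine ⟨2 * Real.pi * C, by positivity, fun f f' p K hf hanti hb => ?_⟩
  have hcont : ContinuousOn (fun x => e (f x)) (Set.Icc (p : ℝ) (p + K)) :=
    continuous_e.comp_continuousOn fun x hx => (hf x hx).continuousAt.continuousWithinAt
  obtain rfl | ⟨L, rfl⟩ : K = 0 ∨ ∃ L, K = L + 1 := by
    cases K <;> simp
  · simp; positivity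
  have hmem : ∀ m < L + 1, ∀ y ∈ Set.Icc (0 : ℝ) 1,
      (p + m + y : ℝ) ∈ Set.Icc (p : ℝ) (p + (L + 1 : ℕ)) := by
    intro m hm y hy
    have : (m : ℝ) + 1 ≤ (L + 1 : ℕ) := by exact_mod_cast hm
    have h0 : (0 : ℝ) ≤ m := m.cast_nonneg
    constructor <;> linarith [hy.1, hy.2]
  set W : ℝ → ℂ := fun y => ∑ m ∈ range (L + 1), (e (f (p + m)) - e (f (p + m + y))) with hW
  have hWd : ∀ y ∈ Set.Icc (0 : ℝ) 1, HasDerivAt W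
      (-(2 * Real.pi * Complex.I * ∑ m ∈ range (L + 1), (f' (p + m + y) : ℂ) * e (f (p + m + y)))) y := by
    intro y hy
    rw [mul_sum, ← sum_neg_distrib]
    refine HasDerivAt.fun_sum fun m hm => ?_
    have h1 : HasDerivAt (fun y : ℝ => (p + m + y : ℝ)) 1 y := (hasDerivAt_id y).const_add _
    have h2 := (hf _ (hmem m (mem_range.1 hm) y hy)).comp y h1
    have h3 := (hasDerivAt_e (f (p + m + y))).scomp y h2
    have h4 := h3.const_sub (e (f (p + m)))
    refine h4.congr_deriv ?_
    rw [Complex.real_smul]; push_cast; ring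
  have hWb : ∀ y ∈ Set.Icc (0 : ℝ) 1, ‖W y‖ ≤ 2 * Real.pi * C := by
    intro y hy
    have h0 : W 0 = 0 := by simp [hW]
    have h1 := norm_image_sub_le_of_norm_deriv_le_segment' (f := W) (a := 0) (b := 1)
      (C := 2 * Real.pi * C) (fun x hx => (hWd x hx).hasDerivWithinAt) (fun z hz => ?_) y hy
    · rw [h0, sub_zero] at h1
      refine h1.trans ?_
      have : 0 ≤ 2 * Real.pi * C := by positivity
      nlinarith [hy.2]
    · have hz' : z ∈ Set.Icc (0 : ℝ) 1 := Set.Ico_subset_Icc_self hz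
      rw [norm_neg, norm_mul]
      have h2 : ‖(2 * Real.pi * Complex.I : ℂ)‖ = 2 * Real.pi := by
        simp [abs_of_pos Real.pi_pos]
      rw [h2]
      gcongr
      refine hmain (fun m => f (p + m + z)) (fun m => f' (p + m + z)) L (fun m hm => ?_)
        fun m hm => hb _ (hmem m (by omega) z hz')
      have ha := hmem m (by omega) z hz'
      have hb := hmem (m + 1) (by omega) z hz'
      have hlt : (p + m + z : ℝ) < p + (m + 1 : ℕ) + z := by push_cast; linarith
      have hsub : Set.Icc (p + m + z : ℝ) (p + (m + 1 : ℕ) + z) ⊆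
          Set.Icc (p : ℝ) (p + (L + 1 : ℕ)) := Set.Icc_subset_Icc ha.1 hb.2
      obtain ⟨c, hc, hc'⟩ := exists_hasDerivAt_eq_slope f f' hlt
        (fun x hx => (hf x (hsub hx)).continuousAt.continuousWithinAt)
        (fun x hx => hf x (hsub (Set.Ioo_subset_Icc_self hx)))
      have hden : (p + (m + 1 : ℕ) + z - (p + m + z) : ℝ) = 1 := by push_cast; ring
      rw [hden, div_one] at hc'
      rw [← hc']
      exact ⟨hanti (hsub (Set.Ioo_subset_Icc_self hc)) hb hc.2.le,
        hanti ha (hsub (Set.Ioo_subset_Icc_self hc)) hc.1.le⟩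
  have hint : ∀ m < L + 1, IntervalIntegrable (fun x => e (f x)) MeasureTheory.volume
      (p + m : ℝ) (p + (m + 1 : ℕ)) := by
    intro m hm
    refine ContinuousOn.intervalIntegrable ?_
    refine hcont.mono ?_
    rw [Set.uIcc_of_le (by push_cast; linarith)]
    have a := hmem m hm 0 (by simp)
    have b := hmem m hm 1 (by simp)
    rw [add_zero] at a
    push_cast at b ⊢
    exact Set.Icc_subset_Icc a.1 (by rw [← add_assoc]; exact b.2)
  have hsum := intervalIntegral.sum_integral_adjacent_intervals (a := fun m : ℕ => (p + m : ℝ))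
    (f := fun x => e (f x)) (μ := MeasureTheory.volume) hint
  have hcy : ∀ m ∈ range (L + 1), ContinuousOn (fun y => e (f (p + m + y))) (Set.Icc (0 : ℝ) 1) := by
    intro m hm
    exact hcont.comp (by fun_prop) fun y hy => hmem m (mem_range.1 hm) y hy
  have hW2 : ∑ m ∈ range (L + 1), e (f (p + m)) - ∫ x in (p : ℝ)..(p + (L + 1 : ℕ)), e (f x) =
      ∫ y in (0 : ℝ)..1, W y := by
    have h1 : ∀ m ∈ range (L + 1), IntervalIntegrable (fun y => e (f (p + m + y)))
        MeasureTheory.volume 0 1 := fun m hm =>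
      ContinuousOn.intervalIntegrable (by rw [Set.uIcc_of_le zero_le_one]; exact hcy m hm)
    rw [hW, intervalIntegral.integral_finsetSum
      (fun m hm => (intervalIntegrable_const).sub (h1 m hm))]
    simp only [Nat.cast_zero, add_zero] at hsum
    rw [← hsum, ← sum_sub_distrib]
    refine sum_congr rfl fun m hm => ?_
    rw [intervalIntegral.integral_sub intervalIntegrable_const (h1 m hm)]
    rw [intervalIntegral.integral_comp_add_left (fun x => e (f x))]
    simp [add_assoc]
  rw [hW2]
  refine (intervalIntegral.norm_integral_le_of_norm_le_const (C := 2 * Real.pi * C) ?_).trans ?_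
  · intro y hy
    rw [Set.uIoc_of_le zero_le_one] at hy
    exact hWb y ⟨hy.1.le, hy.2⟩
  · simp

/-- Comparison of an exponential sum with the corresponding integral when the derivative of
the phase is monotone and bounded by `3/4`. -/
lemma exists_sum_sub_integral_le : ∃ C : ℝ, 0 ≤ C ∧ ∀ (f f' : ℝ → ℝ) (a b : ℝ), 0 ≤ a → a ≤ b →
    (∀ x ∈ Set.Icc a b, HasDerivAt f (f' x) x) →
    AntitoneOn f' (Set.Icc a b) → (∀ x ∈ Set.Icc a b, |f' x| ≤ 3 / 4) →
    ‖∑ m ∈ Ioc ⌊a⌋₊ ⌊b⌋₊, e (f m) - ∫ x in a..b, e (f x)‖ ≤ C := by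
  obtain ⟨C, hC, hmain⟩ := exists_sum_sub_integral_le_of_nat
  refine ⟨C + 3, by positivity, fun f f' a b ha hab hf hanti hb => ?_⟩
  have hcont : ContinuousOn (fun x => e (f x)) (Set.Icc a b) :=
    continuous_e.comp_continuousOn fun x hx => (hf x hx).continuousAt.continuousWithinAt
  have hsmall : ∀ u v : ℝ, u ≤ v → v ≤ u + 1 → ‖∫ x in u..v, e (f x)‖ ≤ 1 := by
    intro u v huv hvu
    refine (intervalIntegral.norm_integral_le_of_norm_le_const (C := 1)
      (fun y _ => (norm_e _).le)).trans ?_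
    rw [abs_of_nonneg (by linarith)]; linarith
  have ha1 := Nat.lt_floor_add_one a
  have hb1 := Nat.lt_floor_add_one b
  have ha2 := Nat.floor_le ha
  have hb2 := Nat.floor_le (ha.trans hab)
  rcases Nat.lt_or_ge ⌊a⌋₊ ⌊b⌋₊ with h | h
  swap
  · rw [Ioc_eq_empty (by omega), sum_empty, zero_sub, norm_neg]
    have : (⌊b⌋₊ : ℝ) ≤ ⌊a⌋₊ := by exact_mod_cast h
    exact (hsmall a b hab (by linarith)).trans (by linarith)
  set p : ℕ := ⌊a⌋₊ + 1 with hp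
  obtain ⟨K, hK⟩ : ∃ K, ⌊b⌋₊ = p + K := ⟨⌊b⌋₊ - p, by omega⟩
  have hKr : (p + K : ℝ) = (⌊b⌋₊ : ℝ) := by rw [hK]; push_cast; ring
  have hpr : (p : ℝ) = ⌊a⌋₊ + 1 := by rw [hp]; push_cast; ring
  have hK0 : (0 : ℝ) ≤ K := K.cast_nonneg
  have hsub : Set.Icc (p : ℝ) (p + K) ⊆ Set.Icc a b := Set.Icc_subset_Icc (by linarith) (by linarith)
  have h1 := hmain f f' p K (fun x hx => hf x (hsub hx)) (hanti.mono hsub)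
    fun x hx => hb x (hsub hx)
  have h2 : ∑ m ∈ Ioc ⌊a⌋₊ ⌊b⌋₊, e (f m) = ∑ m ∈ range K, e (f (p + m)) + e (f (p + K)) := by
    have : Ioc ⌊a⌋₊ ⌊b⌋₊ = Ico p (p + K + 1) := by
      ext m; simp only [mem_Ioc, mem_Ico]; omega
    rw [this, sum_Ico_eq_sum_range, show p + K + 1 - p = K + 1 by omega, sum_range_succ]
    push_cast; rfl
  have hI : ∀ u v, a ≤ u → u ≤ v → v ≤ b →
      IntervalIntegrable (fun x => e (f x)) MeasureTheory.volume u v := fun u v h1 h2 h3 =>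
    ContinuousOn.intervalIntegrable (by
      rw [Set.uIcc_of_le h2]; exact hcont.mono (Set.Icc_subset_Icc h1 h3))
  have h3 : ∫ x in a..b, e (f x) = (∫ x in a..p, e (f x)) + (∫ x in (p : ℝ)..(p + K), e (f x)) +
      ∫ x in (p + K : ℝ)..b, e (f x) := by
    rw [intervalIntegral.integral_add_adjacent_intervals (hI _ _ le_rfl (by linarith) (by linarith))
      (hI _ _ (by linarith) (by linarith) (by linarith)),
      intervalIntegral.integral_add_adjacent_intervals (hI _ _ le_rfl (by linarith) (by linarith))
      (hI _ _ (by linarith) (by linarith) (by linarith))]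
  rw [h2, h3]
  have h4 := hsmall a p (by linarith) (by linarith)
  have h5 := hsmall (p + K) b (by linarith) (by linarith)
  have h6 : ∑ m ∈ range K, e (f (p + m)) + e (f (p + K)) - ((∫ x in a..p, e (f x)) +
      (∫ x in (p : ℝ)..(p + K), e (f x)) + ∫ x in (p + K : ℝ)..b, e (f x)) =
      (∑ m ∈ range K, e (f (p + m)) - ∫ x in (p : ℝ)..(p + K), e (f x)) + e (f (p + K)) -
      (∫ x in a..p, e (f x)) - ∫ x in (p + K : ℝ)..b, e (f x) := by ring
  rw [h6]
  refine (norm_sub_le _ _).trans ?_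
  have h7 := norm_sub_le ((∑ m ∈ range K, e (f (p + m)) - ∫ x in (p : ℝ)..(p + K), e (f x)) +
    e (f (p + K))) (∫ x in a..p, e (f x))
  have h8 := norm_add_le (∑ m ∈ range K, e (f (p + m)) - ∫ x in (p : ℝ)..(p + K), e (f x))
    (e (f (p + K)))
  rw [norm_e] at h8
  linarith

/-- Abel's inequality. -/
lemma norm_sum_antitone_mul_le (φ : ℕ → ℝ) (z : ℕ → ℂ) {L : ℕ} (hL : 0 < L) {Z : ℝ}
    (h0 : ∀ n < L, 0 ≤ φ n) (hφ : ∀ n, n + 1 < L → φ (n + 1) ≤ φ n)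
    (hz : ∀ k ≤ L, ‖∑ n ∈ range k, z n‖ ≤ Z) :
    ‖∑ n ∈ range L, (φ n : ℂ) * z n‖ ≤ φ 0 * Z := by
  obtain ⟨K, rfl⟩ : ∃ K, L = K + 1 := ⟨L - 1, by omega⟩
  have key : ∀ k ≤ K, ‖∑ n ∈ range (k + 1), (φ n : ℂ) * z n - φ k * ∑ n ∈ range (k + 1), z n‖
      ≤ (φ 0 - φ k) * Z := by
    intro k
    induction k with
    | zero => simp
    | succ k ih =>
      intro hk
      have h1 := ih (by omega)
      rw [sum_range_succ, sum_range_succ _ (k + 1)]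
      have h2 : ∑ n ∈ range (k + 1), (φ n : ℂ) * z n + φ (k + 1) * z (k + 1) -
          φ (k + 1) * (∑ n ∈ range (k + 1), z n + z (k + 1)) =
          (∑ n ∈ range (k + 1), (φ n : ℂ) * z n - φ k * ∑ n ∈ range (k + 1), z n) +
          ((φ k - φ (k + 1) : ℝ) : ℂ) * ∑ n ∈ range (k + 1), z n := by push_cast; ring
      rw [h2]
      refine (norm_add_le _ _).trans ?_
      have h3 := hφ k (by omega)
      have h4 : ‖((φ k - φ (k + 1) : ℝ) : ℂ) * ∑ n ∈ range (k + 1), z n‖ ≤ (φ k - φ (k + 1)) * Z := by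
        rw [norm_mul, Complex.norm_real, Real.norm_eq_abs, abs_of_nonneg (by linarith)]
        exact mul_le_mul_of_nonneg_left (hz _ (by omega)) (by linarith)
      linarith
  have h1 := key K le_rfl
  have h2 : ‖(φ K : ℂ) * ∑ n ∈ range (K + 1), z n‖ ≤ φ K * Z := by
    rw [norm_mul, Complex.norm_real, Real.norm_eq_abs, abs_of_nonneg (h0 K (by omega))]
    exact mul_le_mul_of_nonneg_left (hz _ le_rfl) (h0 K (by omega))
  have h3 := norm_le_norm_add_norm_sub' (∑ n ∈ range (K + 1), (φ n : ℂ) * z n)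
    (φ K * ∑ n ∈ range (K + 1), z n)
  linarith

lemma exists_level_cut {d : ℝ → ℝ} {a b : ℝ} (hab : a ≤ b) (hc : ContinuousOn d (Set.Icc a b))
    (hd : AntitoneOn d (Set.Icc a b)) (y : ℝ) :
    ∃ u ∈ Set.Icc a b, (u = a ∨ ∀ t ∈ Set.Icc a u, y ≤ d t) ∧
      (u = b ∨ ∀ t ∈ Set.Icc u b, d t ≤ y) := by
  by_cases h1 : d a ≤ y
  · exact ⟨a, ⟨le_rfl, hab⟩, Or.inl rfl,
      Or.inr fun t ht => (hd ⟨le_rfl, hab⟩ ht ht.1).trans h1⟩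
  by_cases h2 : y ≤ d b
  · exact ⟨b, ⟨hab, le_rfl⟩, Or.inr fun t ht => h2.trans (hd ht ⟨hab, le_rfl⟩ ht.2), Or.inl rfl⟩
  obtain ⟨u, hu, rfl⟩ := intermediate_value_Icc' hab hc ⟨(not_le.1 h2).le, (not_le.1 h1).le⟩
  exact ⟨u, hu, Or.inr fun t ht => hd ⟨ht.1, ht.2.trans hu.2⟩ hu ht.2,
    Or.inr fun t ht => hd hu ⟨hu.1.trans ht.1, ht.2⟩ ht.1⟩

section Oscillatory

variable {φ : ℕ → ℝ} {L : ℕ} {ψ d d2 : ℝ → ℝ} {t1 t2 Z : ℝ}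

lemma continuousOn_sum_mul_e (hψ : ∀ t ∈ Set.Icc t1 t2, HasDerivAt ψ (d t) t) :
    ContinuousOn (fun t => ∑ n ∈ range L, (φ n : ℂ) * e (φ n * ψ t)) (Set.Icc t1 t2) := by
  have h : ContinuousOn ψ (Set.Icc t1 t2) := fun t ht => (hψ t ht).continuousAt.continuousWithinAt
  refine continuousOn_finsetSum _ fun n _ => continuousOn_const.mul ?_
  exact continuous_e.comp_continuousOn (continuousOn_const.mul h)

/-- Integration by parts away from stationary points. -/
lemma norm_integral_sum_le_of_le_abs {δ : ℝ} (hδ : 0 < δ) (h12 : t1 ≤ t2)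
    (hψ : ∀ t ∈ Set.Icc t1 t2, HasDerivAt ψ (d t) t)
    (hd : ∀ t ∈ Set.Icc t1 t2, HasDerivAt d (d2 t) t)
    (hd2 : ContinuousOn d2 (Set.Icc t1 t2)) (hneg : ∀ t ∈ Set.Icc t1 t2, d2 t ≤ 0)
    (hdδ : ∀ t ∈ Set.Icc t1 t2, δ ≤ |d t|)
    (hZ : ∀ t ∈ Set.Icc t1 t2, ‖∑ n ∈ range L, e (φ n * ψ t)‖ ≤ Z) :
    ‖∫ t in t1..t2, ∑ n ∈ range L, (φ n : ℂ) * e (φ n * ψ t)‖ ≤ Z / δ := by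
  have hZ0 : 0 ≤ Z := (norm_nonneg _).trans (hZ t1 ⟨le_rfl, h12⟩)
  have hne : ∀ t ∈ Set.Icc t1 t2, d t ≠ 0 := fun t ht h => by
    have := hdδ t ht
    rw [h, abs_zero] at this
    linarith
  have hdc : ContinuousOn d (Set.Icc t1 t2) :=
    fun t ht => (hd t ht).continuousAt.continuousWithinAt
  have hψc : ContinuousOn ψ (Set.Icc t1 t2) :=
    fun t ht => (hψ t ht).continuousAt.continuousWithinAt
  set S : ℝ → ℂ := fun t => ∑ n ∈ range L, e (φ n * ψ t) with hS
  set Y : ℝ → ℂ := fun t => ∑ n ∈ range L, (φ n : ℂ) * e (φ n * ψ t) with hY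
  have hSc : ContinuousOn S (Set.Icc t1 t2) :=
    continuousOn_finsetSum _ fun n _ => continuous_e.comp_continuousOn (continuousOn_const.mul hψc)
  have hYc : ContinuousOn Y (Set.Icc t1 t2) := continuousOn_sum_mul_e hψ
  have hSd : ∀ t ∈ Set.Icc t1 t2, HasDerivAt S (2 * Real.pi * Complex.I * d t * Y t) t := by
    intro t ht
    rw [hY, mul_sum]
    refine HasDerivAt.fun_sum fun n _ => ?_
    refine ((hasDerivAt_e (φ n * ψ t)).scomp t ((hψ t ht).const_mul (φ n))).congr_deriv ?_
    rw [Complex.real_smul]; push_cast; ring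
  set w : ℝ → ℝ := fun t => -d2 t / d t ^ 2 with hw
  have hwd : ∀ t ∈ Set.Icc t1 t2, HasDerivAt (fun t => (d t)⁻¹) (w t) t := fun t ht =>
    (hd t ht).inv (hne t ht)
  have hwc : ContinuousOn w (Set.Icc t1 t2) :=
    hd2.neg.div (hdc.pow 2) fun t ht => pow_ne_zero 2 (hne t ht)
  have hw0 : ∀ t ∈ Set.Icc t1 t2, 0 ≤ w t := fun t ht =>
    div_nonneg (by linarith [hneg t ht]) (sq_nonneg _)
  have hu : Set.uIcc t1 t2 = Set.Icc t1 t2 := Set.uIcc_of_le h12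
  have hwi : IntervalIntegrable w MeasureTheory.volume t1 t2 :=
    ContinuousOn.intervalIntegrable (by rwa [hu])
  have hwI : ∫ t in t1..t2, w t = (d t2)⁻¹ - (d t1)⁻¹ :=
    intervalIntegral.integral_eq_sub_of_hasDerivAt (fun t ht => hwd t (hu ▸ ht)) hwi
  have hSwc : ContinuousOn (fun t => S t * (w t : ℂ)) (Set.Icc t1 t2) :=
    hSc.mul (Complex.continuous_ofReal.comp_continuousOn hwc)
  set c : ℂ := 2 * Real.pi * Complex.I with hcdef
  have hc0 : c ≠ 0 := Complex.two_pi_I_ne_zero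
  have hcn : ‖c‖ = 2 * Real.pi := by simp [hcdef, abs_of_pos Real.pi_pos]
  have hYi : IntervalIntegrable Y MeasureTheory.volume t1 t2 :=
    ContinuousOn.intervalIntegrable (by rwa [hu])
  have hSwi : IntervalIntegrable (fun t => S t * (w t : ℂ)) MeasureTheory.volume t1 t2 :=
    ContinuousOn.intervalIntegrable (by rwa [hu])
  have hFTC : ∫ t in t1..t2, (c * Y t + S t * (w t : ℂ)) =
      S t2 * ((d t2)⁻¹ : ℝ) - S t1 * ((d t1)⁻¹ : ℝ) := by
    refine intervalIntegral.integral_eq_sub_of_hasDerivAt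
      (f := fun t => S t * (((d t)⁻¹ : ℝ) : ℂ)) (fun t ht => ?_)
      ((hYi.const_mul c).add hSwi)
    have ht' := hu ▸ ht
    refine ((hSd t ht').mul (hwd t ht').ofReal_comp).congr_deriv ?_
    have : (d t : ℂ) ≠ 0 := by exact_mod_cast hne t ht'
    push_cast
    field_simp
  rw [intervalIntegral.integral_add (hYi.const_mul c) hSwi,
    intervalIntegral.integral_const_mul] at hFTC
  have hbd : ∀ t ∈ Set.Icc t1 t2, |(d t)⁻¹| ≤ δ⁻¹ := fun t ht => by
    rw [abs_inv]; exact inv_anti₀ hδ (hdδ t ht)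
  have e1 : ∀ t ∈ Set.Icc t1 t2, ‖S t * ((d t)⁻¹ : ℝ)‖ ≤ Z * δ⁻¹ := fun t ht => by
    rw [norm_mul, Complex.norm_real]
    exact mul_le_mul (hZ t ht) (hbd t ht) (norm_nonneg _) hZ0
  have e2 : ‖∫ t in t1..t2, S t * (w t : ℂ)‖ ≤ Z * (2 * δ⁻¹) := by
    have : ‖∫ t in t1..t2, S t * (w t : ℂ)‖ ≤ ∫ t in t1..t2, Z * w t := by
      refine intervalIntegral.norm_integral_le_of_norm_le h12 ?_ (hwi.const_mul Z)
      refine Filter.Eventually.of_forall fun t ht => ?_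
      have ht' : t ∈ Set.Icc t1 t2 := ⟨ht.1.le, ht.2⟩
      rw [norm_mul, Complex.norm_real, Real.norm_of_nonneg (hw0 t ht')]
      exact mul_le_mul_of_nonneg_right (hZ t ht') (hw0 t ht')
    refine this.trans ?_
    rw [intervalIntegral.integral_const_mul, hwI]
    have a := abs_le.1 (hbd t1 ⟨le_rfl, h12⟩)
    have b := abs_le.1 (hbd t2 ⟨h12, le_rfl⟩)
    exact mul_le_mul_of_nonneg_left (by linarith [a.1, b.2]) hZ0
  have e3 : ‖c * ∫ t in t1..t2, Y t‖ ≤ 4 * (Z * δ⁻¹) := by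
    rw [eq_sub_of_add_eq hFTC]
    refine (norm_sub_le _ _).trans ?_
    have := norm_sub_le (S t2 * ((d t2)⁻¹ : ℝ)) (S t1 * ((d t1)⁻¹ : ℝ))
    linarith [e1 t1 ⟨le_rfl, h12⟩, e1 t2 ⟨h12, le_rfl⟩]
  rw [norm_mul, hcn] at e3
  have h3 := Real.pi_gt_three
  have h4 := norm_nonneg (∫ t in t1..t2, Y t)
  rw [div_eq_mul_inv]
  nlinarith

/-- A second derivative estimate for the integral of a weighted exponential sum whose
partial sums are uniformly bounded. -/
lemma norm_integral_sum_le {l : ℝ} (hl : 0 < l) (h12 : t1 ≤ t2)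
    (hφ1 : ∀ n < L, 0 ≤ φ n ∧ φ n ≤ 2) (hφ : ∀ n, n + 1 < L → φ (n + 1) ≤ φ n)
    (hψ : ∀ t ∈ Set.Icc t1 t2, HasDerivAt ψ (d t) t)
    (hd : ∀ t ∈ Set.Icc t1 t2, HasDerivAt d (d2 t) t)
    (hd2 : ContinuousOn d2 (Set.Icc t1 t2)) (hneg : ∀ t ∈ Set.Icc t1 t2, d2 t ≤ -l)
    (hZ : ∀ t ∈ Set.Icc t1 t2, ∀ k ≤ L, ‖∑ n ∈ range k, e (φ n * ψ t)‖ ≤ Z) :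
    ‖∫ t in t1..t2, ∑ n ∈ range L, (φ n : ℂ) * e (φ n * ψ t)‖ ≤ 6 * Z / √l := by
  have hZ0 : 0 ≤ Z := (norm_nonneg _).trans (hZ t1 ⟨le_rfl, h12⟩ L le_rfl)
  have hδ : 0 < √l := Real.sqrt_pos.2 hl
  have hδ2 : √l * √l = l := Real.mul_self_sqrt hl.le
  have hY : ∀ t ∈ Set.Icc t1 t2, ‖∑ n ∈ range L, (φ n : ℂ) * e (φ n * ψ t)‖ ≤ 2 * Z := by
    intro t ht
    obtain rfl | hL := Nat.eq_zero_or_pos L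
    · simpa using hZ0
    refine (norm_sum_antitone_mul_le φ _ hL (fun n hn => (hφ1 n hn).1) hφ (hZ t ht)).trans ?_
    exact mul_le_mul_of_nonneg_right (hφ1 0 hL).2 hZ0
  have hdrop : ∀ x ∈ Set.Icc t1 t2, ∀ y ∈ Set.Icc t1 t2, x ≤ y → l * (y - x) ≤ d x - d y := by
    intro x hx y hy hxy
    rcases hxy.eq_or_lt with rfl | hlt
    · simp
    obtain ⟨c, hc, hc'⟩ := exists_hasDerivAt_eq_slope d d2 hlt
      (fun z hz => (hd z ⟨hx.1.trans hz.1, hz.2.trans hy.2⟩).continuousAt.continuousWithinAt)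
      (fun z hz => hd z ⟨hx.1.trans hz.1.le, hz.2.le.trans hy.2⟩)
    have h1 := hneg c ⟨hx.1.trans hc.1.le, hc.2.le.trans hy.2⟩
    have h2 : 0 < y - x := by linarith
    rw [eq_div_iff h2.ne'] at hc'
    nlinarith
  have hanti : AntitoneOn d (Set.Icc t1 t2) := fun x hx y hy hxy => by
    have := hdrop x hx y hy hxy
    nlinarith
  have hdc : ContinuousOn d (Set.Icc t1 t2) :=
    fun t ht => (hd t ht).continuousAt.continuousWithinAt
  obtain ⟨u, hu, hu1, hu2⟩ := exists_level_cut h12 hdc hanti (√l)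
  have hs1 : Set.Icc u t2 ⊆ Set.Icc t1 t2 := Set.Icc_subset_Icc_left hu.1
  have hs2 : Set.Icc t1 u ⊆ Set.Icc t1 t2 := Set.Icc_subset_Icc_right hu.2
  obtain ⟨v, hv, hv1, hv2⟩ := exists_level_cut hu.2 (hdc.mono hs1) (hanti.mono hs1) (-√l)
  have hs3 : Set.Icc v t2 ⊆ Set.Icc t1 t2 := Set.Icc_subset_Icc_left (hu.1.trans hv.1)
  have hs4 : Set.Icc u v ⊆ Set.Icc t1 t2 := Set.Icc_subset_Icc hu.1 hv.2
  have hYi : ∀ x y, x ≤ y → Set.Icc x y ⊆ Set.Icc t1 t2 → IntervalIntegrable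
      (fun t => ∑ n ∈ range L, (φ n : ℂ) * e (φ n * ψ t)) MeasureTheory.volume x y :=
    fun x y hxy hs => ContinuousOn.intervalIntegrable (by
      rw [Set.uIcc_of_le hxy]; exact (continuousOn_sum_mul_e hψ).mono hs)
  rw [← intervalIntegral.integral_add_adjacent_intervals (hYi t1 u hu.1 hs2) (hYi u t2 hu.2 hs1),
    ← intervalIntegral.integral_add_adjacent_intervals (hYi u v hv.1 hs4) (hYi v t2 hv.2 hs3)]
  have b1 : ‖∫ t in t1..u, ∑ n ∈ range L, (φ n : ℂ) * e (φ n * ψ t)‖ ≤ Z / √l := by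
    rcases hu1 with rfl | hu1
    · rw [intervalIntegral.integral_same, norm_zero]; positivity
    · exact norm_integral_sum_le_of_le_abs hδ hu.1 (fun t ht => hψ t (hs2 ht))
        (fun t ht => hd t (hs2 ht)) (hd2.mono hs2) (fun t ht => (hneg t (hs2 ht)).trans (by linarith))
        (fun t ht => (hu1 t ht).trans (le_abs_self _)) (fun t ht => hZ t (hs2 ht) L le_rfl)
  have b3 : ‖∫ t in v..t2, ∑ n ∈ range L, (φ n : ℂ) * e (φ n * ψ t)‖ ≤ Z / √l := by
    rcases hv2 with rfl | hv2
    · rw [intervalIntegral.integral_same, norm_zero]; positivity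
    · exact norm_integral_sum_le_of_le_abs hδ hv.2 (fun t ht => hψ t (hs3 ht))
        (fun t ht => hd t (hs3 ht)) (hd2.mono hs3) (fun t ht => (hneg t (hs3 ht)).trans (by linarith))
        (fun t ht => by
          have := neg_le_abs (d t)
          linarith [hv2 t ht]) (fun t ht => hZ t (hs3 ht) L le_rfl)
  have hlen : v - u ≤ 2 / √l := by
    rcases hv.1.eq_or_lt with h | h
    · rw [← h, sub_self]; positivity
    have h1 : d u ≤ √l := by
      rcases hu2 with rfl | hu2
      · linarith [hv.2]
      · exact hu2 u ⟨le_rfl, hu.2⟩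
    have h2 : -√l ≤ d v := by
      rcases hv1 with rfl | hv1
      · exact absurd h (lt_irrefl _)
      · exact hv1 v ⟨hv.1, le_rfl⟩
    have h3 := hdrop u hu v (hs1 hv) hv.1
    rw [le_div_iff₀ hδ]
    nlinarith
  have b2 : ‖∫ t in u..v, ∑ n ∈ range L, (φ n : ℂ) * e (φ n * ψ t)‖ ≤ 4 * (Z / √l) := by
    refine (intervalIntegral.norm_integral_le_of_norm_le_const (C := 2 * Z) fun t ht => ?_).trans ?_
    · rw [Set.uIoc_of_le hv.1] at ht
      exact hY t (hs4 ⟨ht.1.le, ht.2⟩)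
    · rw [abs_of_nonneg (by linarith [hv.1])]
      calc 2 * Z * (v - u) ≤ 2 * Z * (2 / √l) := by gcongr
        _ = _ := by ring
  calc _ ≤ Z / √l + (4 * (Z / √l) + Z / √l) :=
        (norm_add_le _ _).trans (add_le_add b1 ((norm_add_le _ _).trans (add_le_add b2 b3)))
    _ = 6 * Z / √l := by ring

end Oscillatory

section Abstract

variable {γ : ℝ}

lemma hasDerivAt_linear_add_rpow (β H γ : ℝ) {t : ℝ} (ht : 0 < t) :
    HasDerivAt (fun t => β * t + H * t ^ γ) (β + γ * H * t ^ (γ - 1)) t := by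
  have h1 := (Real.hasDerivAt_rpow_const (p := γ) (Or.inl ht.ne')).const_mul H
  have h2 := ((hasDerivAt_id t).const_mul β).add h1
  exact h2.congr_deriv (by ring)

lemma hasDerivAt_const_add_rpow (β H γ : ℝ) {t : ℝ} (ht : 0 < t) :
    HasDerivAt (fun t => β + γ * H * t ^ (γ - 1)) (γ * (γ - 1) * H * t ^ (γ - 2)) t := by
  have h1 := (Real.hasDerivAt_rpow_const (p := γ - 1) (Or.inl ht.ne')).const_mul (γ * H)
  have h2 := h1.const_add β
  refine h2.congr_deriv ?_
  rw [show γ - 1 - 1 = γ - 2 by ring]; ring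

lemma rpow_eq_mul_rpow_sub_one {t : ℝ} (ht : 0 < t) : t ^ γ = t * t ^ (γ - 1) := by
  rw [Real.rpow_sub_one ht.ne']; field_simp

/-- One piece of the decomposition, on which the derivative of the phase is within `3/4` of an
integer. -/
lemma exists_norm_sum_piece_le (hγ0 : 1 / 2 < γ) (hγ1 : γ < 1) : ∃ C : ℝ, 0 ≤ C ∧
    ∀ (φ : ℕ → ℝ) (L : ℕ) (β H M F Z t1 t2 : ℝ) (s : ℤ), 0 < H → 0 < M → F = H * M ^ γ →
    16 / (1 - γ) * M ≤ F →
    (∀ n < L, 1 ≤ φ n ∧ φ n ≤ 2) → (∀ n, n + 1 < L → φ (n + 1) ≤ φ n) →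
    (∀ y, (1 - γ) / 16 * F ≤ y → y ≤ 2 * F → ∀ k ≤ L, ‖∑ n ∈ range k, e (φ n * y)‖ ≤ Z) →
    M / 8 ≤ t1 → t1 ≤ t2 → t2 ≤ M →
    (∀ t ∈ Set.Icc t1 t2, |β + γ * H * t ^ (γ - 1) - s| ≤ 3 / 4) →
    ‖∑ n ∈ range L, ∑ m ∈ Ioc ⌊φ n * t1⌋₊ ⌊φ n * t2⌋₊,
      e (β * m + H * (m : ℝ) ^ γ * φ n ^ (1 - γ))‖ ≤ C * (Z * M / √F + L) := by
  obtain ⟨CD, hCD, hD⟩ := exists_sum_sub_integral_le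
  set g := γ * (1 - γ) with hg
  have hg0 : 0 < g := by rw [hg]; nlinarith
  refine ⟨CD + 6 / √g, by positivity, ?_⟩
  intro φ L β H M F Z t1 t2 s hH hM hF hFM hφ1 hφ hZ ht1 h12 ht2 hs
  have hF0 : 0 < F := by rw [hF]; positivity
  have ht1' : 0 < t1 := by linarith
  have hpos : ∀ t ∈ Set.Icc t1 t2, 0 < t := fun t ht => ht1'.trans_le ht.1
  set ψ : ℝ → ℝ := fun t => (β - s) * t + H * t ^ γ with hψ
  set d : ℝ → ℝ := fun t => (β - s) + γ * H * t ^ (γ - 1) with hd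
  set d2 : ℝ → ℝ := fun t => γ * (γ - 1) * H * t ^ (γ - 2) with hd2
  have hd34 : ∀ t ∈ Set.Icc t1 t2, |d t| ≤ 3 / 4 := fun t ht => by
    have := hs t ht
    rwa [show d t = β + γ * H * t ^ (γ - 1) - s by simp only [hd]; ring]
  have hint : ∀ n < L, ‖∑ m ∈ Ioc ⌊φ n * t1⌋₊ ⌊φ n * t2⌋₊,
      e (β * m + H * (m : ℝ) ^ γ * φ n ^ (1 - γ)) -
      ∫ t in t1..t2, (φ n : ℂ) * e (φ n * ψ t)‖ ≤ CD := by
    intro n hn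
    have hp : 0 < φ n := by linarith [(hφ1 n hn).1]
    have hposx : ∀ x ∈ Set.Icc (φ n * t1) (φ n * t2), 0 < x := fun x hx =>
      (mul_pos hp ht1').trans_le hx.1
    have hdx : ∀ x ∈ Set.Icc (φ n * t1) (φ n * t2), x / φ n ∈ Set.Icc t1 t2 := fun x hx =>
      ⟨by rw [le_div_iff₀ hp]; linarith [hx.1], by rw [div_le_iff₀ hp]; linarith [hx.2]⟩
    have hdiv : ∀ x, 0 < x → x ^ (γ - 1) * φ n ^ (1 - γ) = (x / φ n) ^ (γ - 1) := fun x hx => by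
      rw [Real.div_rpow hx.le hp.le, div_eq_mul_inv, ← Real.rpow_neg hp.le, neg_sub]
    have h1 := hD (fun x => (β - s) * x + (H * φ n ^ (1 - γ)) * x ^ γ)
      (fun x => d (x / φ n)) (φ n * t1) (φ n * t2) (by positivity)
      (mul_le_mul_of_nonneg_left h12 hp.le) (fun x hx => ?_) (fun x hx y hy hxy => ?_)
      (fun x hx => hd34 _ (hdx x hx))
    · have h2 : ∑ m ∈ Ioc ⌊φ n * t1⌋₊ ⌊φ n * t2⌋₊,
          e ((β - s) * (m : ℝ) + H * φ n ^ (1 - γ) * (m : ℝ) ^ γ) =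
          ∑ m ∈ Ioc ⌊φ n * t1⌋₊ ⌊φ n * t2⌋₊, e (β * m + H * (m : ℝ) ^ γ * φ n ^ (1 - γ)) := by
        refine sum_congr rfl fun m _ => ?_
        rw [show (β - s) * (m : ℝ) + H * φ n ^ (1 - γ) * (m : ℝ) ^ γ =
          (β * m + H * (m : ℝ) ^ γ * φ n ^ (1 - γ)) + ((-(s * m) : ℤ) : ℝ) by push_cast; ring,
          e_add, e_int, mul_one]
      have h3 : ∫ x in (φ n * t1)..(φ n * t2), e ((β - s) * x + H * φ n ^ (1 - γ) * x ^ γ) =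
          ∫ t in t1..t2, (φ n : ℂ) * e (φ n * ψ t) := by
        rw [intervalIntegral.integral_const_mul]
        have h4 := intervalIntegral.smul_integral_comp_mul_left
          (fun x => e ((β - s) * x + H * φ n ^ (1 - γ) * x ^ γ)) (φ n) (a := t1) (b := t2)
        rw [← h4, Complex.real_smul]
        congr 1
        refine intervalIntegral.integral_congr fun t ht => ?_
        rw [Set.uIcc_of_le h12] at ht
        have ht0 := hpos t ht
        simp only [hψ]
        congr 1
        rw [Real.mul_rpow hp.le ht0.le]
        have : φ n ^ (1 - γ) * φ n ^ γ = φ n := by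
          rw [← Real.rpow_add hp]; simp
        linear_combination H * t ^ γ * this
      rwa [h2, h3] at h1
    · have hx0 := hposx x hx
      refine (hasDerivAt_linear_add_rpow (β - s) (H * φ n ^ (1 - γ)) γ hx0).congr_deriv ?_
      simp only [hd]
      rw [← hdiv x hx0]; ring
    · have hx0 := hposx x hx
      simp only [hd]
      have : (y / φ n) ^ (γ - 1) ≤ (x / φ n) ^ (γ - 1) :=
        Real.rpow_le_rpow_of_nonpos (by positivity) (by gcongr) (by linarith)
      gcongr
  have hψd : ∀ t ∈ Set.Icc t1 t2, HasDerivAt ψ (d t) t := fun t ht =>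
    hasDerivAt_linear_add_rpow (β - s) H γ (hpos t ht)
  have hdd : ∀ t ∈ Set.Icc t1 t2, HasDerivAt d (d2 t) t := fun t ht =>
    hasDerivAt_const_add_rpow (β - s) H γ (hpos t ht)
  have hd2c : ContinuousOn d2 (Set.Icc t1 t2) := by
    refine continuousOn_const.mul fun t ht => ?_
    exact (Real.continuousAt_rpow_const _ _ (Or.inl (hpos t ht).ne')).continuousWithinAt
  have hneg : ∀ t ∈ Set.Icc t1 t2, d2 t ≤ -(g * F / M ^ 2) := by
    intro t ht
    have h1 : M ^ (γ - 2) ≤ t ^ (γ - 2) :=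
      Real.rpow_le_rpow_of_nonpos (hpos t ht) (ht.2.trans ht2) (by linarith)
    have h2 : F / M ^ 2 = H * M ^ (γ - 2) := by
      rw [hF, Real.rpow_sub hM, Real.rpow_two]; ring
    rw [mul_div_assoc, h2]
    simp only [hd2, hg]
    have h3 : γ * (1 - γ) * H * M ^ (γ - 2) ≤ γ * (1 - γ) * H * t ^ (γ - 2) := by
      gcongr
    linarith
  have hrange : ∀ t ∈ Set.Icc t1 t2, (1 - γ) / 16 * F ≤ ψ t ∧ ψ t ≤ 2 * F := by
    intro t ht
    have ht0 := hpos t ht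
    have h1 : ψ t = t * d t + (1 - γ) * (H * t ^ γ) := by
      simp only [hψ, hd]
      rw [rpow_eq_mul_rpow_sub_one (γ := γ) ht0]; ring
    have h2 := abs_le.1 (hd34 t ht)
    have h3 : t ≤ M := ht.2.trans ht2
    have h4 : H * t ^ γ ≤ F := by
      rw [hF]; gcongr
    have h5 : F / 8 ≤ H * t ^ γ := by
      have h6 : (M / 8) ^ γ ≤ t ^ γ := Real.rpow_le_rpow (by positivity) (ht1.trans ht.1) (by linarith)
      have h7 : M ^ γ / 8 ≤ (M / 8) ^ γ := by
        rw [Real.div_rpow hM.le (by norm_num)]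
        gcongr
        calc (8 : ℝ) ^ γ ≤ 8 ^ (1 : ℝ) := Real.rpow_le_rpow_of_exponent_le (by norm_num) hγ1.le
          _ = 8 := Real.rpow_one 8
      rw [hF, mul_div_assoc]
      exact mul_le_mul_of_nonneg_left (h7.trans h6) hH.le
    have h8 : 16 * M ≤ (1 - γ) * F := by
      rw [div_mul_eq_mul_div, div_le_iff₀ (by linarith)] at hFM
      linarith
    have h9 : M ≤ F := by nlinarith
    rw [h1]
    constructor
    · nlinarith
    · nlinarith
  have hO := norm_integral_sum_le (φ := φ) (L := L) (Z := Z) (l := g * F / M ^ 2) (by positivity) h12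
    (fun n hn => ⟨by linarith [(hφ1 n hn).1], (hφ1 n hn).2⟩) hφ hψd hdd hd2c hneg
    fun t ht k hk => hZ (ψ t) (hrange t ht).1 (hrange t ht).2 k hk
  have hZ0 : 0 ≤ Z := (norm_nonneg _).trans
    (hZ (ψ t1) (hrange t1 ⟨le_rfl, h12⟩).1 (hrange t1 ⟨le_rfl, h12⟩).2 L le_rfl)
  have hsq : 6 * Z / √(g * F / M ^ 2) = 6 / √g * (Z * M / √F) := by
    rw [Real.sqrt_div (by positivity), Real.sqrt_mul hg0.le, Real.sqrt_sq hM.le]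
    field_simp
  rw [hsq, intervalIntegral.integral_finsetSum] at hO
  · have hdiff : ‖∑ n ∈ range L, (∑ m ∈ Ioc ⌊φ n * t1⌋₊ ⌊φ n * t2⌋₊,
        e (β * m + H * (m : ℝ) ^ γ * φ n ^ (1 - γ)) -
        ∫ t in t1..t2, (φ n : ℂ) * e (φ n * ψ t))‖ ≤ CD * L := by
      refine (norm_sum_le _ _).trans
        ((sum_le_sum fun n hn => hint n (mem_range.1 hn)).trans ?_)
      rw [sum_const, card_range, nsmul_eq_mul, mul_comm]
    rw [sum_sub_distrib] at hdiff
    have := norm_le_norm_add_norm_sub' (∑ n ∈ range L, ∑ m ∈ Ioc ⌊φ n * t1⌋₊ ⌊φ n * t2⌋₊,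
        e (β * m + H * (m : ℝ) ^ γ * φ n ^ (1 - γ)))
        (∑ n ∈ range L, ∫ t in t1..t2, (φ n : ℂ) * e (φ n * ψ t))
    have a1 : 0 ≤ CD * (Z * M / √F) := by positivity
    have a2 : 0 ≤ 6 / √g * L := by positivity
    linarith
  · intro n hn
    refine ContinuousOn.intervalIntegrable ?_
    rw [Set.uIcc_of_le h12]
    have h : ContinuousOn ψ (Set.Icc t1 t2) := fun t ht => (hψd t ht).continuousAt.continuousWithinAt
    exact continuousOn_const.mul (continuous_e.comp_continuousOn (continuousOn_const.mul h))

lemma sum_range_sum_Ioc (a : ℕ → ℕ) (ha : Monotone a) (f : ℕ → ℂ) (R : ℕ) :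
    ∑ i ∈ range R, ∑ m ∈ Ioc (a i) (a (i + 1)), f m = ∑ m ∈ Ioc (a 0) (a R), f m := by
  induction R with
  | zero => simp
  | succ R ih =>
    rw [sum_range_succ, ih, sum_Ioc_consecutive _ (ha (Nat.zero_le R)) (ha (Nat.le_succ R))]

/-- A bound for a two-dimensional exponential sum, by Poisson summation in one variable
without the stationary phase expansion. -/
lemma exists_norm_double_sum_le (hγ0 : 1 / 2 < γ) (hγ1 : γ < 1) : ∃ C : ℝ, 0 ≤ C ∧
    ∀ (φ : ℕ → ℝ) (L : ℕ) (β H M F Z : ℝ), 0 < H → 0 < M → F = H * M ^ γ →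
    16 / (1 - γ) * M ≤ F →
    (∀ n < L, 1 ≤ φ n ∧ φ n ≤ 2) → (∀ n, n + 1 < L → φ (n + 1) ≤ φ n) →
    (∀ y, (1 - γ) / 16 * F ≤ y → y ≤ 2 * F → ∀ k ≤ L, ‖∑ n ∈ range k, e (φ n * y)‖ ≤ Z) →
    ‖∑ n ∈ range L, ∑ m ∈ Ioc ⌊φ n * (M / 8)⌋₊ ⌊φ n * M⌋₊,
      e (β * m + H * (m : ℝ) ^ γ * φ n ^ (1 - γ))‖ ≤ C * (F / M * (Z * M / √F + L)) := by
  obtain ⟨C, hC, hmain⟩ := exists_norm_sum_piece_le hγ0 hγ1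
  refine ⟨128 * C, by positivity, ?_⟩
  intro φ L β H M F Z hH hM hF hFM hφ1 hφ hZ
  have hF0 : 0 < F := by rw [hF]; positivity
  have hMF : M ≤ F := by
    refine le_trans ?_ hFM
    have : 1 ≤ 16 / (1 - γ) := by rw [le_div_iff₀ (by linarith)]; linarith
    nlinarith
  set R : ℕ := ⌈64 * F / M⌉₊ with hR
  have hR1 : 64 * F / M ≤ R := Nat.le_ceil _
  have hFM1 : 1 ≤ F / M := by rwa [one_le_div hM]
  have hR2 : (R : ℝ) ≤ 128 * (F / M) := by
    have := Nat.ceil_lt_add_one (a := 64 * F / M) (by positivity)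
    rw [mul_div_assoc] at this
    rw [hR, mul_div_assoc]
    linarith
  have hR0 : (0 : ℝ) < R := lt_of_lt_of_le (by positivity) hR1
  set w : ℝ := 7 * M / 8 / R with hw
  have hw0 : 0 ≤ w := by positivity
  have hwb : 64 * F / M * w ≤ 7 * M / 8 := by
    rw [hw]
    calc 64 * F / M * (7 * M / 8 / R) ≤ R * (7 * M / 8 / R) := by gcongr
      _ = _ := by field_simp
  set t : ℕ → ℝ := fun i => M / 8 + i * w with ht
  have htm : Monotone t := by
    refine monotone_nat_of_le_succ fun i => ?_
    simp only [ht]; push_cast; linarith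
  have ht0 : t 0 = M / 8 := by simp [ht]
  have htR : t R = M := by simp only [ht, hw]; field_simp; ring
  have hpiece : ∀ i ∈ range R, ‖∑ n ∈ range L, ∑ m ∈ Ioc ⌊φ n * t i⌋₊ ⌊φ n * t (i + 1)⌋₊,
      e (β * m + H * (m : ℝ) ^ γ * φ n ^ (1 - γ))‖ ≤ C * (Z * M / √F + L) := by
    intro i hi
    have hi' := mem_range.1 hi
    have h0 : M / 8 ≤ t i := ht0 ▸ htm (Nat.zero_le i)
    have h1 : t (i + 1) ≤ M := htR ▸ htm hi'
    refine hmain φ L β H M F Z (t i) (t (i + 1)) (round (β + γ * H * (t i) ^ (γ - 1))) hH hM hF hFM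
      hφ1 hφ hZ h0 (htm (Nat.le_succ i)) h1 fun x hx => ?_
    have hr := abs_le.1 (abs_sub_round (β + γ * H * (t i) ^ (γ - 1)))
    have hti : 0 < t i := by linarith
    have hx0 : 0 < x := hti.trans_le hx.1
    have hdec : x ^ (γ - 1) ≤ (t i) ^ (γ - 1) :=
      Real.rpow_le_rpow_of_nonpos hti hx.1 (by linarith)
    have hup : γ * H * x ^ (γ - 1) ≤ γ * H * (t i) ^ (γ - 1) := by gcongr
    have hlow : γ * H * (t i) ^ (γ - 1) - γ * H * x ^ (γ - 1) ≤ 1 / 4 := by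
      rcases hx.1.eq_or_lt with h | hlt
      · rw [h]; norm_num
      obtain ⟨c, hc, hc'⟩ := exists_hasDerivAt_eq_slope (fun t => 0 + γ * H * t ^ (γ - 1))
        (fun t => γ * (γ - 1) * H * t ^ (γ - 2)) hlt
        (fun z hz => (hasDerivAt_const_add_rpow 0 H γ
          (hti.trans_le hz.1)).continuousAt.continuousWithinAt)
        (fun z hz => hasDerivAt_const_add_rpow 0 H γ (hti.trans hz.1))
      have hxt : x - t i ≤ w := by
        have : t (i + 1) = t i + w := by simp only [ht]; push_cast; ring
        linarith [hx.2]
      have hxt0 : 0 < x - t i := by linarith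
      rw [eq_div_iff hxt0.ne'] at hc'
      have hcb : c ^ (γ - 2) ≤ 64 * M ^ (γ - 2) := by
        calc c ^ (γ - 2) ≤ (M / 8) ^ (γ - 2) :=
              Real.rpow_le_rpow_of_nonpos (by positivity) (h0.trans hc.1.le) (by linarith)
          _ = 8 ^ (2 - γ) * M ^ (γ - 2) := by
              rw [Real.div_rpow hM.le (by norm_num), div_eq_mul_inv,
                ← Real.rpow_neg (by norm_num), neg_sub, mul_comm]
          _ ≤ 64 * M ^ (γ - 2) := by
              gcongr
              calc (8 : ℝ) ^ (2 - γ) ≤ 8 ^ (2 : ℝ) :=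
                    Real.rpow_le_rpow_of_exponent_le (by norm_num) (by linarith)
                _ = 64 := by rw [Real.rpow_two]; norm_num
      have hFM2 : H * M ^ (γ - 2) = F / M / M := by
        rw [hF, Real.rpow_sub hM, Real.rpow_two]; field_simp
      have hg : γ * (1 - γ) ≤ 1 / 4 := by nlinarith [sq_nonneg (γ - 1 / 2)]
      have hg0 : 0 ≤ γ * (1 - γ) := by nlinarith
      have hc0 : 0 < c := hti.trans hc.1
      have hfin : γ * (1 - γ) * H * c ^ (γ - 2) * (x - t i) ≤ 1 / 4 * (7 / 8) := by
        calc γ * (1 - γ) * H * c ^ (γ - 2) * (x - t i)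
            ≤ 1 / 4 * H * (64 * M ^ (γ - 2)) * w := by gcongr
          _ = 1 / 4 * (64 * F / M * w / M) := by
              rw [show 1 / 4 * H * (64 * M ^ (γ - 2)) * w = 1 / 4 * 64 * (H * M ^ (γ - 2)) * w by ring,
                hFM2]; ring
          _ ≤ 1 / 4 * (7 * M / 8 / M) := by gcongr
          _ = _ := by field_simp
      linarith
    rw [abs_le]
    constructor <;> linarith [hr.1, hr.2]
  have hsplit : ∑ n ∈ range L, ∑ m ∈ Ioc ⌊φ n * (M / 8)⌋₊ ⌊φ n * M⌋₊,
      e (β * m + H * (m : ℝ) ^ γ * φ n ^ (1 - γ)) =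
      ∑ i ∈ range R, ∑ n ∈ range L, ∑ m ∈ Ioc ⌊φ n * t i⌋₊ ⌊φ n * t (i + 1)⌋₊,
        e (β * m + H * (m : ℝ) ^ γ * φ n ^ (1 - γ)) := by
    rw [sum_comm]
    refine sum_congr rfl fun n hn => ?_
    have hmono : Monotone fun i => ⌊φ n * t i⌋₊ := fun i j hij =>
      Nat.floor_mono (mul_le_mul_of_nonneg_left (htm hij)
        (by linarith [(hφ1 n (mem_range.1 hn)).1]))
    rw [sum_range_sum_Ioc _ hmono (fun m => e (β * m + H * (m : ℝ) ^ γ * φ n ^ (1 - γ))), ht0, htR]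
  have hZ0 : 0 ≤ Z := (norm_nonneg _).trans (hZ (2 * F) (by nlinarith) le_rfl L le_rfl)
  rw [hsplit]
  refine (norm_sum_le _ _).trans ((sum_le_sum hpiece).trans ?_)
  rw [sum_const, card_range, nsmul_eq_mul]
  calc (R : ℝ) * (C * (Z * M / √F + L)) ≤ 128 * (F / M) * (C * (Z * M / √F + L)) := by gcongr
    _ = _ := by ring

end Abstract

/-- The Weyl–van der Corput inequality, averaged over a family of sums. -/
lemma sum_norm_sq_sum_le {ι : Type*} (S : Finset ι) (z : ι → ℕ → ℂ) (L Q : ℕ) (hQ : 0 < Q) :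
    ∑ m ∈ S, ‖∑ n ∈ range L, z m n‖ ^ 2 ≤ 2 * (L + Q) / Q * ∑ q ∈ range Q,
      ‖∑ m ∈ S, ∑ n ∈ range (L - q), z m (n + q) * starRingEnd ℂ (z m n)‖ := by
  set Y : ι → ℕ → ℕ → ℂ := fun m k j => if j ≤ k ∧ k - j < L then z m (k - j) else 0 with hY
  set B : ℕ → ℝ := fun q =>
    ‖∑ m ∈ S, ∑ n ∈ range (L - q), z m (n + q) * starRingEnd ℂ (z m n)‖ with hB
  have hcorr : ∀ m, ∀ j' < Q, ∀ j ≤ j', ∑ k ∈ range (L + Q), Y m k j * starRingEnd ℂ (Y m k j') =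
      ∑ n ∈ range (L - (j' - j)), z m (n + (j' - j)) * starRingEnd ℂ (z m n) := by
    intro m j' hj' j hj
    symm
    refine sum_of_injOn (fun n => n + j') (fun a _ b _ h => by simpa using h) ?_ ?_ ?_
    · intro n hn
      simp only [coe_range, Set.mem_Iio] at hn ⊢
      omega
    · intro k hk hk'
      simp only [hY]
      split_ifs with h1 h2
      · exfalso
        apply hk'
        refine ⟨k - j', ?_, ?_⟩
        · simp only [coe_range, Set.mem_Iio]; omega
        · simp only; omega
      all_goals simp
    · intro n hn
      have hn := mem_range.1 hn
      simp only [hY]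
      rw [if_pos (by omega), if_pos (by omega), show n + j' - j = n + (j' - j) by omega,
        show n + j' - j' = n by omega]
  have hsum : ∀ m, ∑ k ∈ range (L + Q), ∑ j ∈ range Q, Y m k j = Q * ∑ n ∈ range L, z m n := by
    intro m
    rw [sum_comm]
    have : ∀ j ∈ range Q, ∑ k ∈ range (L + Q), Y m k j = ∑ n ∈ range L, z m n := by
      intro j hj
      have hj := mem_range.1 hj
      symm
      refine sum_of_injOn (fun n => n + j) (fun a _ b _ h => by simpa using h) ?_ ?_ ?_
      · intro n hn
        simp only [coe_range, Set.mem_Iio] at hn ⊢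
        omega
      · intro k hk hk'
        simp only [hY]
        split_ifs with h1
        · exfalso
          apply hk'
          refine ⟨k - j, ?_, ?_⟩
          · simp only [coe_range, Set.mem_Iio]; omega
          · simp only; omega
        · rfl
      · intro n hn
        have hn := mem_range.1 hn
        simp only [hY]
        rw [if_pos (by omega), show n + j - j = n by omega]
    rw [sum_congr rfl this, sum_const, card_range, nsmul_eq_mul]
  have hcs : ∀ m, (Q : ℝ) ^ 2 * ‖∑ n ∈ range L, z m n‖ ^ 2 ≤
      (L + Q) * ∑ k ∈ range (L + Q), ‖∑ j ∈ range Q, Y m k j‖ ^ 2 := by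
    intro m
    have h1 : (Q : ℝ) ^ 2 * ‖∑ n ∈ range L, z m n‖ ^ 2 =
        ‖∑ k ∈ range (L + Q), ∑ j ∈ range Q, Y m k j‖ ^ 2 := by
      rw [hsum, norm_mul, mul_pow, Complex.norm_natCast]
    rw [h1]
    calc _ ≤ (∑ k ∈ range (L + Q), ‖∑ j ∈ range Q, Y m k j‖) ^ 2 := by
          gcongr; exact norm_sum_le _ _
      _ ≤ _ := by
          refine sq_sum_le_card_mul_sum_sq.trans_eq ?_
          rw [card_range]; push_cast; rfl
  have hT : ∀ j < Q, ∀ j' < Q, ‖∑ m ∈ S, ∑ k ∈ range (L + Q), Y m k j * starRingEnd ℂ (Y m k j')‖ ≤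
      B (max j j' - min j j') := by
    intro j hj j' hj'
    rcases le_total j j' with h | h
    · rw [max_eq_right h, min_eq_left h]
      simp only [hcorr _ j' hj' j h]
      exact le_rfl
    · rw [max_eq_left h, min_eq_right h]
      rw [← RCLike.norm_conj]
      simp only [map_sum, map_mul, RingHomCompTriple.comp_apply, RingHom.id_apply]
      simp only [mul_comm (starRingEnd ℂ _)]
      simp only [hcorr _ j hj j' h]
      exact le_rfl
  have hBn : ∀ q, 0 ≤ B q := fun q => norm_nonneg _
  have hrow : ∀ j < Q, ∑ j' ∈ range Q, B (max j j' - min j j') ≤ 2 * ∑ q ∈ range Q, B q := by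
    intro j hj
    rw [← sum_filter_add_sum_filter_not (range Q) (fun j' => j' ≤ j), two_mul]
    refine add_le_add ?_ ?_
    · rw [sum_congr rfl (g := fun j' => B (j - j')) fun j' hj' => by
        rw [mem_filter] at hj'; rw [max_eq_left hj'.2, min_eq_right hj'.2]]
      rw [← sum_image (s := (range Q).filter (fun j' => j' ≤ j)) (g := fun j' => j - j') (f := B)]
      · refine sum_le_sum_of_subset_of_nonneg ?_ fun q _ _ => hBn q
        intro q hq
        simp only [mem_image, mem_filter, mem_range] at hq ⊢
        omega
      · intro a ha b hb h
        simp only [coe_filter, mem_range, Set.mem_ofPred_eq] at ha hb h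
        omega
    · rw [sum_congr rfl (g := fun j' => B (j' - j)) fun j' hj' => by
        rw [mem_filter, not_le] at hj'; rw [max_eq_right hj'.2.le, min_eq_left hj'.2.le]]
      rw [← sum_image (s := (range Q).filter (fun j' => ¬ j' ≤ j)) (g := fun j' => j' - j) (f := B)]
      · refine sum_le_sum_of_subset_of_nonneg ?_ fun q _ _ => hBn q
        intro q hq
        simp only [mem_image, mem_filter, mem_range] at hq ⊢
        omega
      · intro a ha b hb h
        simp only [coe_filter, mem_range, Set.mem_ofPred_eq] at ha hb h
        omega
  have hexp : ((∑ m ∈ S, ∑ k ∈ range (L + Q), ‖∑ j ∈ range Q, Y m k j‖ ^ 2 : ℝ) : ℂ) =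
      ∑ j ∈ range Q, ∑ j' ∈ range Q, ∑ m ∈ S, ∑ k ∈ range (L + Q),
        Y m k j * starRingEnd ℂ (Y m k j') := by
    have h1 : ∀ m k, ((‖∑ j ∈ range Q, Y m k j‖ ^ 2 : ℝ) : ℂ) =
        ∑ j ∈ range Q, ∑ j' ∈ range Q, Y m k j * starRingEnd ℂ (Y m k j') := by
      intro m k
      rw [Complex.ofReal_pow, ← Complex.mul_conj', map_sum, sum_mul_sum]
    rw [Complex.ofReal_sum]
    simp only [Complex.ofReal_sum, h1]
    rw [sum_congr rfl fun m _ => sum_comm, sum_comm]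
    refine sum_congr rfl fun j _ => ?_
    rw [sum_congr rfl fun m _ => sum_comm, sum_comm]
  have htot : ∑ m ∈ S, ∑ k ∈ range (L + Q), ‖∑ j ∈ range Q, Y m k j‖ ^ 2 ≤
      Q * (2 * ∑ q ∈ range Q, B q) := by
    have h0 : 0 ≤ ∑ m ∈ S, ∑ k ∈ range (L + Q), ‖∑ j ∈ range Q, Y m k j‖ ^ 2 :=
      sum_nonneg fun _ _ => sum_nonneg fun _ _ => by positivity
    rw [← Real.norm_of_nonneg h0, ← Complex.norm_real, hexp]
    refine (norm_sum_le _ _).trans ?_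
    calc _ ≤ ∑ j ∈ range Q, 2 * ∑ q ∈ range Q, B q := by
          refine sum_le_sum fun j hj => (norm_sum_le _ _).trans ?_
          refine (sum_le_sum fun j' hj' => hT j (mem_range.1 hj) j' (mem_range.1 hj')).trans ?_
          exact hrow j (mem_range.1 hj)
      _ = _ := by rw [sum_const, card_range, nsmul_eq_mul]
  have hQ' : (0 : ℝ) < Q := by exact_mod_cast hQ
  have hfin : (Q : ℝ) ^ 2 * ∑ m ∈ S, ‖∑ n ∈ range L, z m n‖ ^ 2 ≤
      (L + Q) * (Q * (2 * ∑ q ∈ range Q, B q)) := by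
    rw [mul_sum]
    refine (sum_le_sum fun m _ => hcs m).trans ?_
    rw [← mul_sum]
    gcongr
  rw [div_mul_eq_mul_div, le_div_iff₀ hQ']
  have : (Q : ℝ) * ((∑ m ∈ S, ‖∑ n ∈ range L, z m n‖ ^ 2) * Q) ≤
      Q * (2 * (L + Q) * ∑ q ∈ range Q, B q) := by linarith
  exact le_of_mul_le_mul_left this hQ'

/-- Weights for the completion of incomplete sums. -/
noncomputable def completionWeight (P k : ℕ) : ℝ :=
  if k = 0 then 1 else 1 / (k : ℝ) + 1 / ((P - k : ℕ) : ℝ)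

lemma completionWeight_nonneg (P k : ℕ) : 0 ≤ completionWeight P k := by
  rw [completionWeight]; split_ifs <;> positivity

lemma sum_completionWeight_le {P : ℕ} (hP : 0 < P) :
    ∑ k ∈ range P, completionWeight P k ≤ 3 + 2 * Real.log P := by
  obtain ⟨K, rfl⟩ : ∃ K, P = K + 1 := ⟨P - 1, by omega⟩
  have hlog : ∑ k ∈ range K, (1 / ((k + 1 : ℕ) : ℝ)) ≤ 1 + Real.log (K + 1 : ℕ) := by
    have h1 := harmonic_le_one_add_log K
    have h2 : ((harmonic K : ℚ) : ℝ) = ∑ k ∈ range K, (1 / ((k + 1 : ℕ) : ℝ)) := by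
      rw [harmonic]; push_cast; simp
    rw [← h2]
    refine h1.trans ?_
    obtain rfl | hK := Nat.eq_zero_or_pos K
    · simp
    · have : Real.log K ≤ Real.log (K + 1 : ℕ) :=
        Real.log_le_log (by exact_mod_cast hK) (by push_cast; linarith)
      linarith
  rw [sum_range_succ']
  have h0 : completionWeight (K + 1) 0 = 1 := by simp [completionWeight]
  have h1 : ∑ k ∈ range K, completionWeight (K + 1) (k + 1) =
      ∑ k ∈ range K, (1 / ((k + 1 : ℕ) : ℝ)) + ∑ k ∈ range K, (1 / ((K - 1 - k + 1 : ℕ) : ℝ)) := by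
    rw [← sum_add_distrib]
    refine sum_congr rfl fun k hk => ?_
    have := mem_range.1 hk
    rw [completionWeight, if_neg (by omega), show K + 1 - (k + 1) = K - 1 - k + 1 by omega]
  rw [h0, h1, sum_range_reflect (fun k => 1 / ((k + 1 : ℕ) : ℝ))]
  linarith

lemma sum_e_mul_div_eq_zero {P : ℕ} {d : ℤ} (hd : d ≠ 0) (hdP : |d| < P) :
    ∑ k ∈ range P, e (k * (d / P : ℝ)) = 0 := by
  have hP : (0 : ℝ) < P := by exact_mod_cast (abs_nonneg d).trans_lt hdP
  have hpow : ∀ k : ℕ, e (k * (d / P : ℝ)) = e (d / P) ^ k := by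
    intro k
    induction k with
    | zero => simp [e_zero]
    | succ k ih =>
      rw [pow_succ, ← ih, ← e_add]; push_cast; ring_nf
  have hne : e (d / P) ≠ 1 := by
    rw [Ne, e_eq_one_iff]
    rintro ⟨n, hn⟩
    rw [div_eq_iff hP.ne'] at hn
    have hn' : d = n * P := by exact_mod_cast hn
    have hn0 : n ≠ 0 := by rintro rfl; simp at hn'; exact hd hn'
    rw [hn', abs_mul, Nat.abs_cast] at hdP
    have := Int.one_le_abs hn0
    nlinarith
  simp only [hpow]
  rw [geom_sum_eq hne, ← hpow, mul_div_cancel₀ _ hP.ne', e_int, sub_self, zero_div]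

lemma norm_sum_e_linear_le {P k : ℕ} (hk : 0 < k) (hkP : k < P) (a b : ℕ) :
    ‖∑ j ∈ Ico a b, e (k * (j / P : ℝ))‖ ≤ P * completionWeight P k := by
  have hP : (0 : ℝ) < P := by exact_mod_cast hk.trans hkP
  have hk0 : (0 : ℝ) < k := by exact_mod_cast hk
  have hPk : (0 : ℝ) < (P - k : ℕ) := by exact_mod_cast Nat.sub_pos_of_lt hkP
  have hcast : ((P - k : ℕ) : ℝ) = P - k := Nat.cast_sub hkP.le
  rw [sum_Ico_eq_sum_range]
  have hdiff : ∀ n : ℕ, (k : ℝ) * ((a + (n + 1) : ℕ) / P : ℝ) - k * ((a + n : ℕ) / P : ℝ) = k / P := by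
    intro n; push_cast; field_simp; ring
  have h1 := kusmin_landau (fun n => (k : ℝ) * ((a + n : ℕ) / P : ℝ)) (b - a) 0
    (δ := min (k / P) ((P - k : ℕ) / P)) (lt_min (by positivity) (by positivity))
    (fun n _ => by
      have h1 := hdiff n
      have h2 := hdiff (n + 1)
      rw [h1]; exact h2.ge)
    (fun n _ => by rw [hdiff]; simp)
    (fun n _ => by
      rw [hdiff]
      have := min_le_right ((k : ℝ) / P) ((P - k : ℕ) / P)
      have h3 : ((P - k : ℕ) / P : ℝ) = 1 - k / P := by rw [hcast]; field_simp
      push_cast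
      linarith)
  refine h1.trans ?_
  rw [completionWeight, if_neg hk.ne', mul_add, ← div_eq_mul_one_div, ← div_eq_mul_one_div]
  rcases min_choice ((k : ℝ) / P) ((P - k : ℕ) / P) with h | h
  · rw [h, one_div_div]; linarith [div_pos hP hPk]
  · rw [h, one_div_div]; linarith [div_pos hP hk0]

/-- Completion of an incomplete sum. -/
lemma norm_sum_Ico_le_completion (z : ℕ → ℂ) {a b A B P : ℕ} (hP : 0 < P) (hA : A ≤ a) (hB : b ≤ B)
    (hAB : B ≤ A + P) :
    ‖∑ n ∈ Ico a b, z n‖ ≤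
      ∑ k ∈ range P, completionWeight P k * ‖∑ n ∈ Ico A B, z n * e (k * (n / P : ℝ))‖ := by
  have hP' : (0 : ℝ) < P := by exact_mod_cast hP
  have hPc : (P : ℂ) ≠ 0 := by exact_mod_cast hP.ne'
  have horth : ∀ n ∈ Ico A B, ∑ j ∈ Ico a b, ∑ k ∈ range P,
      e (k * (n / P : ℝ)) * e (-(k * (j / P : ℝ))) = if n ∈ Ico a b then (P : ℂ) else 0 := by
    intro n hn
    have hn := mem_Ico.1 hn
    have h1 : ∀ j ∈ Ico a b, ∑ k ∈ range P, e (k * (n / P : ℝ)) * e (-(k * (j / P : ℝ))) =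
        if n = j then (P : ℂ) else 0 := by
      intro j hj
      have hj := mem_Ico.1 hj
      split_ifs with h
      · subst h
        simp [← e_add, e_zero]
      · rw [← sum_e_mul_div_eq_zero (P := P) (d := (n : ℤ) - j) (by omega) (by rw [abs_lt]; omega)]
        refine sum_congr rfl fun k _ => ?_
        rw [← e_add]; push_cast; ring_nf
    rw [sum_congr rfl h1, sum_ite_eq]
  have hid : (P : ℂ) * ∑ n ∈ Ico a b, z n = ∑ k ∈ range P, (∑ j ∈ Ico a b, e (-(k * (j / P : ℝ)))) *
      ∑ n ∈ Ico A B, z n * e (k * (n / P : ℝ)) := by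
    have h1 : (P : ℂ) * ∑ n ∈ Ico a b, z n =
        ∑ n ∈ Ico A B, z n * if n ∈ Ico a b then (P : ℂ) else 0 := by
      simp only [mul_ite, mul_zero]
      rw [← sum_filter, mul_sum]
      refine sum_congr ?_ fun _ _ => mul_comm _ _
      ext n; simp only [mem_filter, mem_Ico]; omega
    rw [h1, sum_congr rfl fun n hn => by rw [← horth n hn]]
    simp only [mul_sum, sum_mul]
    rw [sum_comm]
    rw [sum_congr rfl fun j _ => sum_comm, sum_comm]
    refine sum_congr rfl fun k _ => ?_
    rw [sum_comm]
    refine sum_congr rfl fun n _ => sum_congr rfl fun j _ => by ring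
  have hfin : (P : ℝ) * ‖∑ n ∈ Ico a b, z n‖ ≤ P * ∑ k ∈ range P, completionWeight P k *
      ‖∑ n ∈ Ico A B, z n * e (k * (n / P : ℝ))‖ := by
    rw [← Complex.norm_natCast, ← norm_mul, hid, mul_sum]
    refine (norm_sum_le _ _).trans (sum_le_sum fun k hk => ?_)
    have hk := mem_range.1 hk
    rw [norm_mul, ← mul_assoc, norm_sum_e_neg, Complex.norm_natCast]
    gcongr
    obtain rfl | hk0 := Nat.eq_zero_or_pos k
    · refine (norm_sum_e_le _ _).trans ?_
      rw [Nat.card_Ico, completionWeight, if_pos rfl, mul_one]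
      exact_mod_cast (by omega : b - a ≤ P)
    · exact norm_sum_e_linear_le hk0 hk a b
  exact le_of_mul_le_mul_left hfin hP'

lemma exists_second_diff_eq {f f' f'' : ℝ → ℝ} {a : ℝ}
    (h1 : ∀ x ∈ Set.Icc a (a + 2), HasDerivAt f (f' x) x)
    (h2 : ∀ x ∈ Set.Icc a (a + 2), HasDerivAt f' (f'' x) x) :
    ∃ ξ ∈ Set.Icc a (a + 2), f (a + 2) - 2 * f (a + 1) + f a = f'' ξ := by
  have hd : ∀ x ∈ Set.Icc a (a + 1), HasDerivAt (fun x => f (x + 1) - f x) (f' (x + 1) - f' x) x := by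
    intro x hx
    have ha := h1 (x + 1) ⟨by linarith [hx.1], by linarith [hx.2]⟩
    exact (ha.comp_add_const x 1).sub (h1 x ⟨hx.1, by linarith [hx.2]⟩)
  obtain ⟨c, hc, hc'⟩ := exists_hasDerivAt_eq_slope _ _ (show a < a + 1 by linarith)
    (fun x hx => (hd x hx).continuousAt.continuousWithinAt)
    (fun x hx => hd x (Set.Ioo_subset_Icc_self hx))
  have hsub : Set.Icc c (c + 1) ⊆ Set.Icc a (a + 2) :=
    Set.Icc_subset_Icc hc.1.le (by linarith [hc.2])
  obtain ⟨ξ, hξ, hξ'⟩ := exists_hasDerivAt_eq_slope f' f'' (show c < c + 1 by linarith)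
    (fun x hx => (h2 x (hsub hx)).continuousAt.continuousWithinAt)
    (fun x hx => h2 x (hsub (Set.Ioo_subset_Icc_self hx)))
  refine ⟨ξ, hsub (Set.Ioo_subset_Icc_self hξ), ?_⟩
  rw [hξ', add_sub_cancel_left, div_one, hc', add_sub_cancel_left, div_one,
    show a + 1 + 1 = a + 2 by ring]
  ring

lemma exists_rpow_add_sub_rpow_eq (p : ℝ) {q x : ℝ} (hq : 0 < q) (hx : 0 < x) :
    ∃ ξ ∈ Set.Icc x (x + q), (x + q) ^ p - x ^ p = q * (p * ξ ^ (p - 1)) := by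
  have hd : ∀ y ∈ Set.Icc x (x + q), HasDerivAt (fun y : ℝ => y ^ p) (p * y ^ (p - 1)) y :=
    fun y hy => Real.hasDerivAt_rpow_const (Or.inl (hx.trans_le hy.1).ne')
  obtain ⟨c, hc, hc'⟩ := exists_hasDerivAt_eq_slope _ _ (show x < x + q by linarith)
    (fun y hy => (hd y hy).continuousAt.continuousWithinAt)
    (fun y hy => hd y (Set.Ioo_subset_Icc_self hy))
  refine ⟨c, Set.Ioo_subset_Icc_self hc, ?_⟩
  rw [hc', add_sub_cancel_left]
  field_simp

/-- Size of negative powers on a dyadic interval. -/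
lemma rpow_dyadic_bounds {s N ξ : ℝ} (hs : s ≤ 0) (hN : 0 < N) (h1 : N / 2 ≤ ξ) (h2 : ξ ≤ N) :
    N ^ s ≤ ξ ^ s ∧ ξ ^ s ≤ 2 ^ (-s) * N ^ s := by
  have hξ : 0 < ξ := by linarith
  refine ⟨Real.rpow_le_rpow_of_nonpos hξ h2 hs, ?_⟩
  refine (Real.rpow_le_rpow_of_nonpos (by positivity) h1 hs).trans_eq ?_
  rw [Real.div_rpow hN.le (by norm_num), Real.rpow_neg (by norm_num)]
  field_simp

section Shift

variable {γ q N : ℝ}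

/-- The normalised difference `(x + q) ^ γ - x ^ γ` and its first two derivatives. -/
lemma exists_shift_profile (hγ0 : 1 / 2 < γ) (hγ1 : γ < 1) (hq : 0 < q) (hN : 0 < N) :
    ∃ g g' g'' : ℝ → ℝ, ∀ x, N / 2 ≤ x → x + q ≤ N →
      HasDerivAt g (g' x) x ∧ HasDerivAt g' (g'' x) x ∧
      (1 ≤ g x ∧ g x ≤ 2 ^ (1 - γ)) ∧ (1 - γ ≤ -(N * g' x) ∧ -(N * g' x) ≤ 4 * (1 - γ)) ∧
      ((1 - γ) * (2 - γ) ≤ N ^ 2 * g'' x ∧ N ^ 2 * g'' x ≤ 8 * ((1 - γ) * (2 - γ))) ∧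
      (x + q) ^ γ - x ^ γ = γ * q * N ^ (γ - 1) * g x := by
  have hN1 : 0 < N ^ (γ - 1) := by positivity
  refine ⟨fun x => ((x + q) ^ γ - x ^ γ) / (γ * q * N ^ (γ - 1)),
    fun x => (γ * (x + q) ^ (γ - 1) - γ * x ^ (γ - 1)) / (γ * q * N ^ (γ - 1)),
    fun x => (γ * ((γ - 1) * (x + q) ^ (γ - 1 - 1)) - γ * ((γ - 1) * x ^ (γ - 1 - 1))) /
      (γ * q * N ^ (γ - 1)), fun x hx1 hx2 => ?_⟩
  have hx : 0 < x := by linarith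
  have hxq : 0 < x + q := by linarith
  have hγ : 0 < γ := by linarith
  have hder : ∀ p : ℝ, HasDerivAt (fun x : ℝ => (x + q) ^ p) (p * (x + q) ^ (p - 1)) x := fun p =>
    (Real.hasDerivAt_rpow_const (p := p) (Or.inl hxq.ne')).comp_add_const x q
  have hder' : ∀ p : ℝ, HasDerivAt (fun x : ℝ => x ^ p) (p * x ^ (p - 1)) x := fun p =>
    Real.hasDerivAt_rpow_const (p := p) (Or.inl hx.ne')
  have hb : ∀ ξ ∈ Set.Icc x (x + q), ∀ s ≤ (0 : ℝ), N ^ s ≤ ξ ^ s ∧ ξ ^ s ≤ 2 ^ (-s) * N ^ s :=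
    fun ξ hξ s hs => rpow_dyadic_bounds hs hN (hx1.trans hξ.1) (hξ.2.trans hx2)
  refine ⟨((hder γ).sub (hder' γ)).div_const _,
    (((hder (γ - 1)).const_mul γ).sub ((hder' (γ - 1)).const_mul γ)).div_const _, ?_, ?_, ?_, ?_⟩
  · obtain ⟨ξ, hξ, h⟩ := exists_rpow_add_sub_rpow_eq γ hq hx
    obtain ⟨h1, h2⟩ := hb ξ hξ (γ - 1) (by linarith)
    rw [neg_sub] at h2
    have h3 : ((x + q) ^ γ - x ^ γ) / (γ * q * N ^ (γ - 1)) = ξ ^ (γ - 1) / N ^ (γ - 1) := by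
      rw [h]; field_simp
    simp only [h3]
    exact ⟨(one_le_div hN1).2 h1, (div_le_iff₀ hN1).2 h2⟩
  · obtain ⟨ξ, hξ, h⟩ := exists_rpow_add_sub_rpow_eq (γ - 1) hq hx
    obtain ⟨h1, h2⟩ := hb ξ hξ (γ - 1 - 1) (by linarith)
    have h3 : -(N * ((γ * (x + q) ^ (γ - 1) - γ * x ^ (γ - 1)) / (γ * q * N ^ (γ - 1)))) =
        (1 - γ) * (ξ ^ (γ - 1 - 1) / N ^ (γ - 1 - 1)) := by
      rw [← mul_sub, h, Real.rpow_sub_one hN.ne' (γ - 1)]; field_simp; ring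
    have h4 : (2 : ℝ) ^ (-(γ - 1 - 1)) ≤ 4 := by
      calc (2 : ℝ) ^ (-(γ - 1 - 1)) ≤ 2 ^ (2 : ℝ) :=
            Real.rpow_le_rpow_of_exponent_le (by norm_num) (by linarith)
        _ = 4 := by rw [Real.rpow_two]; norm_num
    have hN2 : 0 < N ^ (γ - 1 - 1) := by positivity
    have h5 : 1 ≤ ξ ^ (γ - 1 - 1) / N ^ (γ - 1 - 1) := (one_le_div hN2).2 h1
    have h6 : ξ ^ (γ - 1 - 1) / N ^ (γ - 1 - 1) ≤ 4 := (div_le_iff₀ hN2).2 (h2.trans (by gcongr))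
    simp only [h3]
    constructor <;> nlinarith
  · obtain ⟨ξ, hξ, h⟩ := exists_rpow_add_sub_rpow_eq (γ - 1 - 1) hq hx
    obtain ⟨h1, h2⟩ := hb ξ hξ (γ - 1 - 1 - 1) (by linarith)
    have h3 : N ^ 2 * ((γ * ((γ - 1) * (x + q) ^ (γ - 1 - 1)) - γ * ((γ - 1) * x ^ (γ - 1 - 1))) /
        (γ * q * N ^ (γ - 1))) =
        (1 - γ) * (2 - γ) * (ξ ^ (γ - 1 - 1 - 1) / N ^ (γ - 1 - 1 - 1)) := by
      rw [← mul_sub, ← mul_sub, h, Real.rpow_sub_one hN.ne' (γ - 1 - 1),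
        Real.rpow_sub_one hN.ne' (γ - 1)]; field_simp; ring
    have h4 : (2 : ℝ) ^ (-(γ - 1 - 1 - 1)) ≤ 8 := by
      calc (2 : ℝ) ^ (-(γ - 1 - 1 - 1)) ≤ 2 ^ (3 : ℝ) :=
            Real.rpow_le_rpow_of_exponent_le (by norm_num) (by linarith)
        _ = 8 := by norm_num
    have hN2 : 0 < N ^ (γ - 1 - 1 - 1) := by positivity
    have h5 : 1 ≤ ξ ^ (γ - 1 - 1 - 1) / N ^ (γ - 1 - 1 - 1) := (one_le_div hN2).2 h1
    have h6 : ξ ^ (γ - 1 - 1 - 1) / N ^ (γ - 1 - 1 - 1) ≤ 8 :=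
      (div_le_iff₀ hN2).2 (h2.trans (by gcongr))
    have h7 : 0 < (1 - γ) * (2 - γ) := mul_pos (by linarith) (by linarith)
    simp only [h3]
    constructor <;> nlinarith
  · field_simp

/-- The normalised difference as a `(1 - γ)`-th power of a convex decreasing function. -/
lemma exists_shift_power_profile (hγ0 : 1 / 2 < γ) (hγ1 : γ < 1) (hq : 0 < q) (hN : 0 < N) :
    ∃ φ φ' φ'' : ℝ → ℝ, ∀ x, N / 2 ≤ x → x + q ≤ N →
      HasDerivAt φ (φ' x) x ∧ HasDerivAt φ' (φ'' x) x ∧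
      (1 ≤ φ x ∧ φ x ≤ 2) ∧ φ' x ≤ 0 ∧ (1 ≤ N ^ 2 * φ'' x ∧ N ^ 2 * φ'' x ≤ 48) ∧
      (x + q) ^ γ - x ^ γ = γ * q * N ^ (γ - 1) * φ x ^ (1 - γ) := by
  obtain ⟨g, g', g'', hg⟩ := exists_shift_profile hγ0 hγ1 hq hN
  set p : ℝ := (1 - γ)⁻¹ with hp
  have hδ : 0 < 1 - γ := by linarith
  have hp2 : 2 ≤ p := by
    rw [hp]; exact (le_inv_comm₀ (by norm_num) hδ).2 (by norm_num; linarith)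
  have hpδ : p * (1 - γ) = 1 := inv_mul_cancel₀ hδ.ne'
  refine ⟨fun x => g x ^ p, fun x => g' x * p * g x ^ (p - 1),
    fun x => g'' x * p * g x ^ (p - 1) + g' x * p * (g' x * (p - 1) * g x ^ (p - 1 - 1)),
    fun x hx1 hx2 => ?_⟩
  obtain ⟨h1, h2, ⟨h3, h4⟩, ⟨h5, h6⟩, ⟨h7, h8⟩, h9⟩ := hg x hx1 hx2
  have hg0 : 0 < g x := by linarith
  have hpow : ∀ s : ℝ, 0 ≤ s → s ≤ p → 1 ≤ g x ^ s ∧ g x ^ s ≤ 2 := by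
    intro s hs hsp
    refine ⟨Real.one_le_rpow h3 hs, ?_⟩
    calc g x ^ s ≤ g x ^ p := Real.rpow_le_rpow_of_exponent_le h3 hsp
      _ ≤ (2 ^ (1 - γ)) ^ p := Real.rpow_le_rpow hg0.le h4 (by linarith)
      _ = 2 := by rw [← Real.rpow_mul (by norm_num), mul_comm, hpδ, Real.rpow_one]
  have hg'0 : g' x ≤ 0 := by nlinarith
  obtain ⟨a1, a2⟩ := hpow (p - 1) (by linarith) (by linarith)
  obtain ⟨b1, b2⟩ := hpow (p - 1 - 1) (by linarith) (by linarith)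
  refine ⟨h1.rpow_const (Or.inl hg0.ne'), ?_, hpow p (by linarith) le_rfl, ?_, ?_, ?_⟩
  · exact (h2.mul_const p).mul (h1.rpow_const (p := p - 1) (Or.inl hg0.ne'))
  · exact mul_nonpos_of_nonpos_of_nonneg (mul_nonpos_of_nonpos_of_nonneg hg'0 (by linarith))
      (by positivity)
  · have hA : N ^ 2 * (g'' x * p * g x ^ (p - 1) +
        g' x * p * (g' x * (p - 1) * g x ^ (p - 1 - 1))) =
        (N ^ 2 * g'' x * p) * g x ^ (p - 1) +
        ((-(N * g' x)) ^ 2 * (p * (p - 1))) * g x ^ (p - 1 - 1) := by ring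
    have hB1 : 2 - γ ≤ N ^ 2 * g'' x * p := by
      calc 2 - γ = (1 - γ) * (2 - γ) * p := by linear_combination (-(2 - γ)) * hpδ
        _ ≤ _ := by gcongr
    have hB2 : N ^ 2 * g'' x * p ≤ 8 * (2 - γ) := by
      calc N ^ 2 * g'' x * p ≤ 8 * ((1 - γ) * (2 - γ)) * p := by gcongr
        _ = _ := by linear_combination (8 * (2 - γ)) * hpδ
    have hpp : (1 - γ) ^ 2 * (p * (p - 1)) = γ := by
      linear_combination (p * (1 - γ) + γ) * hpδ
    have hpp0 : 0 ≤ p * (p - 1) := mul_nonneg (by linarith) (by linarith)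
    have hC1 : γ ≤ (-(N * g' x)) ^ 2 * (p * (p - 1)) := by
      rw [← hpp]; gcongr
    have hC2 : (-(N * g' x)) ^ 2 * (p * (p - 1)) ≤ 16 * γ := by
      calc (-(N * g' x)) ^ 2 * (p * (p - 1)) ≤ (4 * (1 - γ)) ^ 2 * (p * (p - 1)) := by
            gcongr; linarith
        _ = _ := by linear_combination 16 * hpp
    simp only [hA]
    constructor <;> nlinarith
  · simp only
    rw [← Real.rpow_mul hg0.le, hpδ, Real.rpow_one, h9]

end Shift

lemma dyN_eq_Ico (Y : ℝ) : dyN Y = Ico ⌈Y / 2⌉₊ ⌈Y⌉₊ := by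
  ext m
  simp only [dyN, mem_filter, mem_range, mem_Ico, Nat.ceil_le, Nat.lt_ceil]
  constructor
  · rintro ⟨_, h1, h2⟩; exact ⟨h1, h2⟩
  · rintro ⟨h1, h2⟩
    exact ⟨(Nat.lt_ceil.2 h2).trans (Nat.lt_succ_self _), h1, h2⟩

lemma mem_dyN {Y : ℝ} {m : ℕ} : m ∈ dyN Y ↔ Y / 2 ≤ m ∧ (m : ℝ) < Y := by
  rw [dyN_eq_Ico, mem_Ico, Nat.ceil_le, Nat.lt_ceil]

lemma ceil_sub_ceil_half_le {Y : ℝ} (hY : 1 ≤ Y) : ((⌈Y⌉₊ - ⌈Y / 2⌉₊ : ℕ) : ℝ) ≤ 2 * Y := by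
  have h1 := Nat.ceil_lt_add_one (a := Y) (by linarith)
  have h2 : ((⌈Y⌉₊ - ⌈Y / 2⌉₊ : ℕ) : ℝ) ≤ (⌈Y⌉₊ : ℝ) := by exact_mod_cast Nat.sub_le _ _
  linarith

lemma card_dyN_le {Y : ℝ} (hY : 1 ≤ Y) : ((dyN Y).card : ℝ) ≤ 2 * Y := by
  rw [dyN_eq_Ico, Nat.card_Ico]; exact ceil_sub_ceil_half_le hY

lemma norm_sum_e_le_of_second_diff (f : ℕ → ℝ) (L : ℕ) {a b F B : ℝ} (ha : 0 < a) (hab : a ≤ b)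
    (hF : 0 < F) (hB : 0 < B) (hL : (L : ℝ) ≤ 2 * B)
    (h : ∀ n, n + 2 < L → a * F ≤ B ^ 2 * (f (n + 2) - 2 * f (n + 1) + f n) ∧
      B ^ 2 * (f (n + 2) - 2 * f (n + 1) + f n) ≤ b * F) :
    ‖∑ n ∈ range L, e (f n)‖ ≤ 16 * (b + 1) / √a * (√F + B / √F) := by
  have hB2 : 0 < B ^ 2 := by positivity
  have h1 := van_der_corput_inside f L (l := a * F / B ^ 2) (u := b * F / B ^ 2) (by positivity)
    (by gcongr) (fun n hn => by rw [div_le_iff₀' hB2]; exact (h n hn).1)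
    (fun n hn => by rw [le_div_iff₀' hB2]; exact (h n hn).2)
  refine h1.trans ?_
  have hb : 0 < b := by linarith
  have hsF : 0 < √F := Real.sqrt_pos.2 hF
  have hsa : 0 < √a := Real.sqrt_pos.2 ha
  have hsF2 : F = √F * √F := (Real.mul_self_sqrt hF.le).symm
  rw [Real.sqrt_div (by positivity), Real.sqrt_mul ha.le, Real.sqrt_sq hB.le]
  calc 8 * (L * (b * F / B ^ 2) + 2) / (√a * √F / B)
      ≤ 8 * (2 * B * (b * F / B ^ 2) + 2) / (√a * √F / B) := by gcongr
    _ = 16 * b / √a * (F / √F) + 16 / √a * (B / √F) := by field_simp; norm_num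
    _ = 16 * b / √a * √F + 16 / √a * (B / √F) := by rw [Real.div_sqrt]
    _ ≤ 16 * (b + 1) / √a * √F + 16 * (b + 1) / √a * (B / √F) := by
        gcongr
        · linarith
        · linarith
    _ = _ := by ring

lemma rpow_mem_dyN {γ M : ℝ} {m : ℕ} (hγ0 : 0 < γ) (hγ1 : γ < 1) (hM : 0 < M) (hm : m ∈ dyN M) :
    M ^ γ / 2 ≤ (m : ℝ) ^ γ ∧ (m : ℝ) ^ γ ≤ M ^ γ := by
  obtain ⟨h1, h2⟩ := mem_dyN.1 hm
  refine ⟨?_, Real.rpow_le_rpow (Nat.cast_nonneg _) h2.le hγ0.le⟩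
  refine le_trans ?_ (Real.rpow_le_rpow (by positivity) h1 hγ0.le)
  rw [Real.div_rpow hM.le (by norm_num)]
  gcongr
  calc (2 : ℝ) ^ γ ≤ 2 ^ (1 : ℝ) := Real.rpow_le_rpow_of_exponent_le (by norm_num) hγ1.le
    _ = 2 := Real.rpow_one 2

section Differenced

variable {γ : ℝ}

/-- Bound for the differenced sum by the second derivative test in the variable `n`. -/
lemma exists_differenced_le_of_inner (hγ0 : 1 / 2 < γ) (hγ1 : γ < 1) : ∃ C : ℝ, 0 ≤ C ∧
    ∀ (β h M N A q : ℝ) (K : ℕ), 0 < h → 1 ≤ M → 1 ≤ N → 0 < q → (K : ℝ) ≤ 2 * N →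
    (∀ j < K, N / 2 ≤ A + j ∧ A + j + q ≤ N) →
    ‖∑ m ∈ dyN M, ∑ j ∈ range K, e (β * m + h * (m : ℝ) ^ γ * ((A + j + q) ^ γ - (A + j) ^ γ))‖ ≤
      C * (M * (√(h * (γ * q * N ^ (γ - 1)) * M ^ γ) + N / √(h * (γ * q * N ^ (γ - 1)) * M ^ γ))) := by
  set c : ℝ := (1 - γ) * (2 - γ) with hc
  have hc0 : 0 < c := mul_pos (by linarith) (by linarith)
  have hγ : 0 < γ := by linarith
  refine ⟨2 * (16 * (8 * c + 1) / √(c / 2)), by positivity, ?_⟩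
  intro β h M N A q K hh hM hN hq hK hA
  obtain ⟨g, g', g'', hg⟩ := exists_shift_profile hγ0 hγ1 hq (by linarith : 0 < N)
  set H := h * (γ * q * N ^ (γ - 1)) with hH
  have hN0 : 0 < N := by linarith
  have hM0 : 0 < M := by linarith
  have hH0 : 0 < H := by positivity
  have hinner : ∀ m ∈ dyN M, ‖∑ j ∈ range K,
      e (β * m + h * (m : ℝ) ^ γ * ((A + j + q) ^ γ - (A + j) ^ γ))‖ ≤
      16 * (8 * c + 1) / √(c / 2) * (√(H * M ^ γ) + N / √(H * M ^ γ)) := by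
    intro m hm
    obtain ⟨hm1, hm2⟩ := rpow_mem_dyN hγ hγ1 hM0 hm
    refine norm_sum_e_le_of_second_diff _ K (by positivity) (by linarith) (by positivity) hN0 hK
      fun n hn => ?_
    have hin : ∀ x ∈ Set.Icc (A + n) (A + n + 2), N / 2 ≤ x ∧ x + q ≤ N := by
      intro x hx
      have h1 := (hA n (by omega)).1
      have h2 := (hA (n + 2) hn).2
      push_cast at h2
      exact ⟨by linarith [hx.1], by linarith [hx.2]⟩
    obtain ⟨ξ, hξ, hξ'⟩ := exists_second_diff_eq (f := g) (f' := g') (f'' := g'') (a := A + n)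
      (fun x hx => (hg x (hin x hx).1 (hin x hx).2).1)
      (fun x hx => (hg x (hin x hx).1 (hin x hx).2).2.1)
    have hval : ∀ x ∈ Set.Icc (A + n) (A + n + 2),
        (x + q) ^ γ - x ^ γ = γ * q * N ^ (γ - 1) * g x := fun x hx =>
      (hg x (hin x hx).1 (hin x hx).2).2.2.2.2.2
    obtain ⟨b1, b2⟩ := (hg ξ (hin ξ hξ).1 (hin ξ hξ).2).2.2.2.2.1
    have e0 := hval (A + n) ⟨le_rfl, by linarith⟩
    have e1 := hval (A + n + 1) ⟨by linarith, by linarith⟩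
    have e2 := hval (A + n + 2) ⟨by linarith, le_rfl⟩
    have heq : N ^ 2 * ((β * m + h * (m : ℝ) ^ γ * ((A + (n + 2 : ℕ) + q) ^ γ - (A + (n + 2 : ℕ)) ^ γ))
        - 2 * (β * m + h * (m : ℝ) ^ γ * ((A + (n + 1 : ℕ) + q) ^ γ - (A + (n + 1 : ℕ)) ^ γ))
        + (β * m + h * (m : ℝ) ^ γ * ((A + n + q) ^ γ - (A + n) ^ γ))) =
        H * (m : ℝ) ^ γ * (N ^ 2 * g'' ξ) := by
      push_cast
      simp only [← add_assoc]
      rw [e0, e1, e2, ← hξ', hH]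
      ring
    rw [heq]
    have hpos : 0 ≤ N ^ 2 * g'' ξ := hc0.le.trans b1
    constructor
    · calc c / 2 * (H * M ^ γ) = H * (M ^ γ / 2) * c := by ring
        _ ≤ _ := by gcongr
    · calc H * (m : ℝ) ^ γ * (N ^ 2 * g'' ξ) ≤ H * M ^ γ * (8 * c) := by gcongr
        _ = _ := by ring
  refine (norm_sum_le _ _).trans ((sum_le_sum hinner).trans ?_)
  rw [sum_const, nsmul_eq_mul]
  have := card_dyN_le hM
  calc _ ≤ 2 * M * (16 * (8 * c + 1) / √(c / 2) * (√(H * M ^ γ) + N / √(H * M ^ γ))) := by gcongr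
    _ = _ := by ring

/-- Bound for the differenced sum by the second derivative test in the variable `m`. -/
lemma exists_differenced_le_of_outer (hγ0 : 1 / 2 < γ) (hγ1 : γ < 1) : ∃ C : ℝ, 0 ≤ C ∧
    ∀ (β h M N A q : ℝ) (K : ℕ), 0 < h → 1 ≤ M → 1 ≤ N → 0 < q → (K : ℝ) ≤ 2 * N →
    (∀ j < K, N / 2 ≤ A + j ∧ A + j + q ≤ N) →
    ‖∑ m ∈ dyN M, ∑ j ∈ range K, e (β * m + h * (m : ℝ) ^ γ * ((A + j + q) ^ γ - (A + j) ^ γ))‖ ≤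
      C * (N * (√(h * (γ * q * N ^ (γ - 1)) * M ^ γ) + M / √(h * (γ * q * N ^ (γ - 1)) * M ^ γ))) := by
  set c : ℝ := γ * (1 - γ) with hc
  have hc0 : 0 < c := mul_pos (by linarith) (by linarith)
  have hγ : 0 < γ := by linarith
  refine ⟨2 * (16 * (8 * c + 1) / √c), by positivity, ?_⟩
  intro β h M N A q K hh hM hN hq hK hA
  obtain ⟨g, g', g'', hg⟩ := exists_shift_profile hγ0 hγ1 hq (by linarith : 0 < N)
  set H := h * (γ * q * N ^ (γ - 1)) with hH
  have hN0 : 0 < N := by linarith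
  have hM0 : 0 < M := by linarith
  have hH0 : 0 < H := by positivity
  have hinner : ∀ j ∈ range K, ‖∑ m ∈ dyN M,
      e (β * m + h * (m : ℝ) ^ γ * ((A + j + q) ^ γ - (A + j) ^ γ))‖ ≤
      16 * (8 * c + 1) / √c * (√(H * M ^ γ) + M / √(H * M ^ γ)) := by
    intro j hj
    obtain ⟨hx1, hx2⟩ := hA j (mem_range.1 hj)
    obtain ⟨-, -, ⟨g1, g2⟩, -, -, hval⟩ := hg _ hx1 hx2
    have g3 : g (A + j) ≤ 2 := g2.trans (by
      calc (2 : ℝ) ^ (1 - γ) ≤ 2 ^ (1 : ℝ) :=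
            Real.rpow_le_rpow_of_exponent_le (by norm_num) (by linarith)
        _ = 2 := Real.rpow_one 2)
    rw [dyN_eq_Ico, sum_Ico_eq_sum_range, ← norm_sum_e_neg]
    set m0 := ⌈M / 2⌉₊ with hm0
    refine norm_sum_e_le_of_second_diff _ _ hc0 (by linarith) (by positivity) hM0
      (ceil_sub_ceil_half_le hM) fun n hn => ?_
    have hin : ∀ x ∈ Set.Icc (m0 + n : ℝ) (m0 + n + 2), M / 2 ≤ x ∧ x ≤ M := by
      intro x hx
      have h1 : M / 2 ≤ m0 := Nat.le_ceil _
      have h2 : ((m0 + (n + 2) : ℕ) : ℝ) < M := Nat.lt_ceil.1 (by omega)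
      push_cast at h2
      have : (0 : ℝ) ≤ n := n.cast_nonneg
      exact ⟨by linarith [hx.1], by linarith [hx.2]⟩
    obtain ⟨ξ, hξ, hξ'⟩ := exists_second_diff_eq (f := fun x => 0 * x + 1 * x ^ γ)
      (a := (m0 + n : ℝ))
      (fun x hx => hasDerivAt_linear_add_rpow 0 1 γ (by linarith [(hin x hx).1]))
      (fun x hx => hasDerivAt_const_add_rpow 0 1 γ (by linarith [(hin x hx).1]))
    obtain ⟨b1, b2⟩ := rpow_dyadic_bounds (s := γ - 2) (by linarith) hM0 (hin ξ hξ).1 (hin ξ hξ).2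
    have b3 : (2 : ℝ) ^ (-(γ - 2)) ≤ 4 := by
      calc (2 : ℝ) ^ (-(γ - 2)) ≤ 2 ^ (2 : ℝ) :=
            Real.rpow_le_rpow_of_exponent_le (by norm_num) (by linarith)
        _ = 4 := by rw [Real.rpow_two]; norm_num
    have hMγ : M ^ 2 * M ^ (γ - 2) = M ^ γ := by
      rw [Real.rpow_sub hM0, Real.rpow_two]; field_simp
    have heq : M ^ 2 * (-(β * (m0 + (n + 2) : ℕ) + h * ((m0 + (n + 2) : ℕ) : ℝ) ^ γ *
          ((A + j + q) ^ γ - (A + j) ^ γ))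
        - 2 * -(β * (m0 + (n + 1) : ℕ) + h * ((m0 + (n + 1) : ℕ) : ℝ) ^ γ *
          ((A + j + q) ^ γ - (A + j) ^ γ))
        + -(β * (m0 + n : ℕ) + h * ((m0 + n : ℕ) : ℝ) ^ γ * ((A + j + q) ^ γ - (A + j) ^ γ))) =
        c * (H * (M ^ 2 * ξ ^ (γ - 2)) * g (A + j)) := by
      push_cast
      rw [hval, ← add_assoc, ← add_assoc, hc, hH]
      linear_combination (-(M ^ 2 * h * (γ * q * N ^ (γ - 1) * g (A + j)))) * hξ'
    rw [heq]
    have hξ0 : 0 < ξ := by linarith [(hin ξ hξ).1]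
    constructor
    · calc c * (H * M ^ γ) = c * (H * (M ^ 2 * M ^ (γ - 2)) * 1) := by rw [hMγ]; ring
        _ ≤ _ := by gcongr
    · calc c * (H * (M ^ 2 * ξ ^ (γ - 2)) * g (A + j))
          ≤ c * (H * (M ^ 2 * (4 * M ^ (γ - 2))) * 2) := by
            gcongr; exact b2.trans (by gcongr)
        _ = 8 * c * (H * (M ^ 2 * M ^ (γ - 2))) := by ring
        _ = _ := by rw [hMγ]
  rw [sum_comm]
  refine (norm_sum_le _ _).trans ((sum_le_sum hinner).trans ?_)
  rw [sum_const, card_range, nsmul_eq_mul]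
  calc _ ≤ 2 * N * (16 * (8 * c + 1) / √c * (√(H * M ^ γ) + M / √(H * M ^ γ))) := by gcongr
    _ = _ := by ring

/-- Bound for the differenced sum by the two-dimensional method. -/
lemma exists_differenced_le_of_double (hγ0 : 1 / 2 < γ) (hγ1 : γ < 1) : ∃ C : ℝ, 0 ≤ C ∧
    ∀ (β h M N A q F : ℝ) (K : ℕ), 0 < h → 1 ≤ M → 1 ≤ N → 0 < q → (K : ℝ) ≤ 2 * N →
    (∀ j < K, N / 2 ≤ A + j ∧ A + j + q ≤ N) → F = h * (γ * q * N ^ (γ - 1)) * M ^ γ →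
    16 / (1 - γ) * M ≤ F →
    ‖∑ m ∈ dyN M, ∑ j ∈ range K, e (β * m + h * (m : ℝ) ^ γ * ((A + j + q) ^ γ - (A + j) ^ γ))‖ ≤
      C * ((3 + 2 * Real.log (2 * M + 1)) * (F + N + N * F / M)) := by
  obtain ⟨C, hC, hmain⟩ := exists_norm_double_sum_le hγ0 hγ1
  set a : ℝ := (1 - γ) / 16 with ha
  have ha0 : 0 < a := by rw [ha]; linarith
  set C1 : ℝ := 16 * (96 + 1) / √a with hC1
  refine ⟨C * (C1 + 2), by positivity, ?_⟩
  intro β h M N A q F K hh hM hN hq hK hA hF hFM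
  obtain ⟨φ, φ', φ'', hφ⟩ := exists_shift_power_profile hγ0 hγ1 hq (by linarith : 0 < N)
  set H := h * (γ * q * N ^ (γ - 1)) with hH
  have hγ : 0 < γ := by linarith
  have hN0 : 0 < N := by linarith
  have hM0 : 0 < M := by linarith
  have hH0 : 0 < H := by positivity
  have hF0 : 0 < F := by rw [hF]; positivity
  have hsF : 0 < √F := Real.sqrt_pos.2 hF0
  set Φ : ℕ → ℝ := fun j => φ (A + j) with hΦ
  have hΦ1 : ∀ n < K, 1 ≤ Φ n ∧ Φ n ≤ 2 := fun n hn =>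
    (hφ _ (hA n hn).1 (hA n hn).2).2.2.1
  have hΦanti : ∀ n, n + 1 < K → Φ (n + 1) ≤ Φ n := by
    intro n hn
    have h1 := (hA n (by omega)).1
    have h2 := (hA (n + 1) hn).2
    push_cast at h2
    obtain ⟨c, hc, hc'⟩ := exists_hasDerivAt_eq_slope φ φ' (show A + n < A + n + 1 by linarith)
      (fun x hx => (hφ x (by linarith [hx.1]) (by linarith [hx.2])).1.continuousAt.continuousWithinAt)
      (fun x hx => (hφ x (by linarith [hx.1]) (by linarith [hx.2])).1)
    have h3 := (hφ c (by linarith [hc.1]) (by linarith [hc.2])).2.2.2.1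
    rw [add_sub_cancel_left, div_one] at hc'
    simp only [hΦ]
    push_cast
    rw [← add_assoc]
    linarith
  have hZ : ∀ y, (1 - γ) / 16 * F ≤ y → y ≤ 2 * F → ∀ k ≤ K,
      ‖∑ n ∈ range k, e (Φ n * y)‖ ≤ C1 * (√F + N / √F) := by
    intro y hy1 hy2 k hk
    have hkr : (k : ℝ) ≤ K := by exact_mod_cast hk
    refine norm_sum_e_le_of_second_diff _ k ha0 (by rw [ha]; linarith) hF0 hN0 (hkr.trans hK)
      fun n hn => ?_
    have hin : ∀ x ∈ Set.Icc (A + n) (A + n + 2), N / 2 ≤ x ∧ x + q ≤ N := by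
      intro x hx
      have h1 := (hA n (by omega)).1
      have h2 := (hA (n + 2) (by omega)).2
      push_cast at h2
      exact ⟨by linarith [hx.1], by linarith [hx.2]⟩
    obtain ⟨ξ, hξ, hξ'⟩ := exists_second_diff_eq (f := φ) (f' := φ') (f'' := φ'') (a := A + n)
      (fun x hx => (hφ x (hin x hx).1 (hin x hx).2).1)
      (fun x hx => (hφ x (hin x hx).1 (hin x hx).2).2.1)
    obtain ⟨b1, b2⟩ := (hφ ξ (hin ξ hξ).1 (hin ξ hξ).2).2.2.2.2.1
    have hy0 : 0 ≤ y := le_trans (by positivity) hy1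
    have heq : N ^ 2 * (Φ (n + 2) * y - 2 * (Φ (n + 1) * y) + Φ n * y) = N ^ 2 * φ'' ξ * y := by
      rw [← hξ']; simp only [hΦ]; push_cast; rw [← add_assoc, ← add_assoc]; ring
    rw [heq]
    constructor
    · calc a * F = 1 * (a * F) := (one_mul _).symm
        _ ≤ _ := by gcongr
    · calc N ^ 2 * φ'' ξ * y ≤ 48 * (2 * F) := by gcongr
        _ = _ := by ring
  set P : ℕ := ⌊2 * M⌋₊ + 1 with hP
  set z : ℕ → ℂ := fun m => ∑ j ∈ range K, if m ∈ Ioc ⌊Φ j * (M / 8)⌋₊ ⌊Φ j * M⌋₊ then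
    e (β * m + H * (m : ℝ) ^ γ * Φ j ^ (1 - γ)) else 0 with hz
  have hzeq : ∑ m ∈ dyN M, ∑ j ∈ range K,
      e (β * m + h * (m : ℝ) ^ γ * ((A + j + q) ^ γ - (A + j) ^ γ)) =
      ∑ m ∈ Ico ⌈M / 2⌉₊ ⌈M⌉₊, z m := by
    rw [← dyN_eq_Ico]
    refine sum_congr rfl fun m hm => sum_congr rfl fun j hj => ?_
    obtain ⟨hm1, hm2⟩ := mem_dyN.1 hm
    have hj := mem_range.1 hj
    have hval := (hφ _ (hA j hj).1 (hA j hj).2).2.2.2.2.2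
    obtain ⟨f1, f2⟩ := hΦ1 j hj
    rw [if_pos]
    · rw [hval, hH]; congr 1; ring
    · rw [mem_Ioc]
      refine ⟨(Nat.floor_lt (by positivity)).2 (by nlinarith), Nat.le_floor (by nlinarith)⟩
  have hcomp := norm_sum_Ico_le_completion z (a := ⌈M / 2⌉₊) (b := ⌈M⌉₊) (A := 0) (B := P) (P := P)
    (by omega) (Nat.zero_le _)
    (Nat.ceil_le.2 (by
      have := Nat.lt_floor_add_one (2 * M)
      rw [hP]; push_cast; linarith)) (by omega)
  have hk : ∀ k ∈ range P, ‖∑ m ∈ Ico 0 P, z m * e (k * (m / P : ℝ))‖ ≤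
      C * (F / M * (C1 * (√F + N / √F) * M / √F + K)) := by
    intro k _
    refine le_trans (le_of_eq ?_) (hmain Φ K (β + k / P) H M F _ hH0 hM0 hF hFM hΦ1 hΦanti hZ)
    congr 1
    simp only [hz, sum_mul]
    rw [sum_comm]
    refine sum_congr rfl fun j hj => ?_
    obtain ⟨f1, f2⟩ := hΦ1 j (mem_range.1 hj)
    simp only [ite_mul, zero_mul]
    rw [← sum_filter]
    refine sum_congr ?_ fun m _ => ?_
    · ext m
      simp only [mem_filter, mem_Ico, mem_Ioc, Nat.zero_le, true_and, and_iff_right_iff_imp]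
      rintro ⟨_, h1⟩
      have : ⌊Φ j * M⌋₊ ≤ ⌊2 * M⌋₊ := Nat.floor_mono (by gcongr)
      omega
    · rw [← e_add]; congr 1; ring
  rw [hzeq]
  refine hcomp.trans ?_
  have hbound : C * (F / M * (C1 * (√F + N / √F) * M / √F + K)) ≤
      C * (C1 + 2) * (F + N + N * F / M) := by
    have h1 : F / M * (C1 * (√F + N / √F) * M / √F + K) = C1 * (F + N * (F / (√F * √F))) + K * F / M := by
      field_simp
    rw [h1, Real.mul_self_sqrt hF0.le, div_self hF0.ne', mul_one, mul_assoc]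
    gcongr
    have h2 : K * F / M ≤ 2 * (N * F / M) := by
      rw [← mul_div_assoc, ← mul_assoc]
      gcongr
    have h3 : 0 ≤ C1 * (N * F / M) := by positivity
    nlinarith
  calc _ ≤ ∑ k ∈ range P, completionWeight P k * (C * (C1 + 2) * (F + N + N * F / M)) := by
        refine sum_le_sum fun k hk' => ?_
        exact mul_le_mul_of_nonneg_left ((hk k hk').trans hbound) (completionWeight_nonneg P k)
    _ = (∑ k ∈ range P, completionWeight P k) * (C * (C1 + 2) * (F + N + N * F / M)) := by
        rw [sum_mul]
    _ ≤ (3 + 2 * Real.log (2 * M + 1)) * (C * (C1 + 2) * (F + N + N * F / M)) := by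
        gcongr
        refine (sum_completionWeight_le (by omega)).trans ?_
        gcongr
        have := Nat.floor_le (a := 2 * M) (by positivity)
        rw [hP]; push_cast; linarith
    _ = _ := by ring

end Differenced

/-- The bound for the differenced sum which results from choosing the best of the available
methods. -/
lemma exists_differenced_le {γ : ℝ} (hγ0 : 1 / 2 < γ) (hγ1 : γ < 1) : ∃ C : ℝ, 0 ≤ C ∧
    ∀ (β h M N A q F K T : ℝ) (J : ℕ), 0 < h → 1 ≤ M → 1 ≤ N → 0 < q → (J : ℝ) ≤ 2 * N →
    (∀ j < J, N / 2 ≤ A + j ∧ A + j + q ≤ N) → F = h * (γ * q * N ^ (γ - 1)) * M ^ γ →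
    1 ≤ K → 1 ≤ T → 3 + 2 * Real.log (2 * M + 1) ≤ T → K ^ 4 * T ≤ N →
    K ^ 18 * T ^ 4 ≤ (M * N) ^ 2 → F ≤ K ^ 2 * M * T + K ^ 4 →
    ‖∑ m ∈ dyN M, ∑ j ∈ range J, e (β * m + h * (m : ℝ) ^ γ * ((A + j + q) ^ γ - (A + j) ^ γ))‖ ≤
      C * (T * (M * N / K ^ 2 + M * N / √F)) := by
  obtain ⟨C₁, hC₁, h₁⟩ := exists_differenced_le_of_inner hγ0 hγ1
  obtain ⟨C₂, hC₂, h₂⟩ := exists_differenced_le_of_outer hγ0 hγ1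
  obtain ⟨C₃, hC₃, h₃⟩ := exists_differenced_le_of_double hγ0 hγ1
  set b : ℝ := 16 / (1 - γ) with hb
  have hb0 : 0 < b := div_pos (by norm_num) (by linarith)
  refine ⟨2 * C₁ + (b + 1) * C₂ + 5 * C₃, by positivity, ?_⟩
  intro β h M N A q F K T J hh hM hN hq hJ hA hF hK hT hlog hKN hKY hFle
  have hγ : 0 < γ := by linarith
  have hN0 : 0 < N := by linarith
  have hM0 : 0 < M := by linarith
  have hK0 : 0 < K := by linarith
  have hT0 : 0 < T := by linarith
  have hF0 : 0 < F := by rw [hF]; positivity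
  set R : ℝ := T * (M * N / K ^ 2 + M * N / √F) with hR
  have hR0 : 0 ≤ R := by positivity
  have hYF : M * N / √F ≤ T * (M * N / √F) := le_mul_of_one_le_left (by positivity) hT
  rcases le_total M (K ^ 4 * T) with hMK | hMK
  · refine (h₁ β h M N A q J hh hM hN hq hJ hA).trans ?_
    rw [← hF]
    have h10 : K ^ 10 * T ^ 2 ≤ N ^ 2 := by
      have h0 : K ^ 8 * T ^ 2 * (K ^ 10 * T ^ 2) ≤ K ^ 8 * T ^ 2 * N ^ 2 := by
        calc K ^ 8 * T ^ 2 * (K ^ 10 * T ^ 2) = K ^ 18 * T ^ 4 := by ring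
          _ ≤ (M * N) ^ 2 := hKY
          _ ≤ (K ^ 4 * T * N) ^ 2 := by gcongr
          _ = _ := by ring
      exact le_of_mul_le_mul_left h0 (by positivity)
    have hFb : K ^ 4 * F ≤ (2 * T * N) ^ 2 := by
      calc K ^ 4 * F ≤ K ^ 4 * (K ^ 2 * (K ^ 4 * T) * T + K ^ 4) := by
            gcongr; exact hFle.trans (by gcongr)
        _ = K ^ 10 * T ^ 2 + K ^ 8 * 1 := by ring
        _ ≤ K ^ 10 * T ^ 2 + K ^ 10 * T ^ 2 := by
            have h8 : K ^ 8 ≤ K ^ 10 := pow_le_pow_right₀ hK (by norm_num)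
            have h2 : 1 ≤ T ^ 2 := one_le_pow₀ hT
            gcongr
        _ ≤ N ^ 2 + N ^ 2 := by gcongr
        _ ≤ 4 * 1 * N ^ 2 := by nlinarith [sq_nonneg N]
        _ ≤ 4 * T ^ 2 * N ^ 2 := by gcongr; exact one_le_pow₀ hT
        _ = _ := by ring
    have hs : √F ≤ 2 * T * N / K ^ 2 := by
      rw [le_div_iff₀ (by positivity)]
      refine le_of_sq_le_sq ?_ (by positivity)
      rw [mul_pow, Real.sq_sqrt hF0.le]
      linarith
    have hb1 : M * (√F + N / √F) ≤ 2 * R := by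
      calc M * (√F + N / √F) = M * √F + M * N / √F := by ring
        _ ≤ M * (2 * T * N / K ^ 2) + T * (M * N / √F) := by gcongr
        _ = 2 * (T * (M * N / K ^ 2)) + T * (M * N / √F) := by ring
        _ ≤ 2 * R := by
          rw [hR]
          have : 0 ≤ T * (M * N / √F) := by positivity
          linarith
    calc C₁ * (M * (√F + N / √F)) ≤ C₁ * (2 * R) := by gcongr
      _ ≤ _ := by
        have : 0 ≤ ((b + 1) * C₂ + 5 * C₃) * R := by positivity
        linarith
  · have hK4M : K ^ 4 ≤ M := le_trans (le_mul_of_one_le_right (by positivity) hT) hMK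
    have hK2M : K ^ 2 ≤ M := (pow_le_pow_right₀ hK (by norm_num)).trans hK4M
    rcases le_total F (b * M) with hFM | hFM
    · refine (h₂ β h M N A q J hh hM hN hq hJ hA).trans ?_
      rw [← hF]
      have hs : √F ≤ (b + 1) * M / K ^ 2 := by
        rw [le_div_iff₀ (by positivity)]
        refine le_of_sq_le_sq ?_ (by positivity)
        rw [mul_pow, Real.sq_sqrt hF0.le]
        calc F * (K ^ 2) ^ 2 = F * K ^ 4 := by ring
          _ ≤ b * M * M := by gcongr
          _ ≤ ((b + 1) * M) ^ 2 := by
              nlinarith [mul_pos hM0 hM0, mul_pos hb0 (mul_pos hM0 hM0),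
                mul_pos (mul_pos hb0 hb0) (mul_pos hM0 hM0)]
      have hb1 : N * (√F + M / √F) ≤ (b + 1) * R := by
        calc N * (√F + M / √F) = N * √F + M * N / √F := by ring
          _ ≤ N * ((b + 1) * M / K ^ 2) + T * (M * N / √F) := by gcongr
          _ = (b + 1) * (1 * (M * N / K ^ 2)) + T * (M * N / √F) := by ring
          _ ≤ (b + 1) * (T * (M * N / K ^ 2)) + T * (M * N / √F) := by gcongr
          _ ≤ (b + 1) * R := by
            rw [hR]
            have : 0 ≤ b * (T * (M * N / √F)) := by positivity
            linarith
      calc C₂ * (N * (√F + M / √F)) ≤ C₂ * ((b + 1) * R) := by gcongr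
        _ ≤ _ := by
          have : 0 ≤ (2 * C₁ + 5 * C₃) * R := by positivity
          linarith
    · refine (h₃ β h M N A q F J hh hM hN hq hJ hA hF hFM).trans ?_
      have hK4N : K ^ 4 ≤ N := le_trans (le_mul_of_one_le_right (by positivity) hT) hKN
      have hK2 : 1 ≤ K ^ 2 := one_le_pow₀ hK
      set E : ℝ := M * N / K ^ 2 with hE
      have t1 : K ^ 2 * M * T ≤ E := by
        rw [hE, le_div_iff₀ (by positivity)]
        calc K ^ 2 * M * T * K ^ 2 = M * (K ^ 4 * T) := by ring
          _ ≤ _ := by gcongr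
      have t3 : N ≤ E := by
        rw [hE, le_div_iff₀ (by positivity), mul_comm]; gcongr
      have t2 : K ^ 4 ≤ E := hK4N.trans t3
      have t4 : N * F / M ≤ 2 * E := by
        calc N * F / M ≤ N * (K ^ 2 * M * T + K ^ 4) / M := by gcongr
          _ = N * K ^ 2 * T + N * (K ^ 4 / M) := by field_simp
          _ ≤ E + N * 1 := by
            gcongr
            · rw [hE, le_div_iff₀ (by positivity)]
              calc N * K ^ 2 * T * K ^ 2 = K ^ 4 * T * N := by ring
                _ ≤ _ := by gcongr
            · exact (div_le_one hM0).2 hK4M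
          _ ≤ _ := by linarith
      have hFE : F ≤ 2 * E := by linarith
      have hb1 : (3 + 2 * Real.log (2 * M + 1)) * (F + N + N * F / M) ≤ 5 * R := by
        calc _ ≤ T * (2 * E + E + 2 * E) := by gcongr
          _ = 5 * (T * E) := by ring
          _ ≤ 5 * R := by
            rw [hR]; gcongr
            have : 0 ≤ M * N / √F := by positivity
            linarith
      calc _ ≤ C₃ * (5 * R) := by gcongr
        _ ≤ _ := by
          have : 0 ≤ (2 * C₁ + (b + 1) * C₂) * R := by positivity
          linarith

lemma sum_range_inv_sqrt_le (n : ℕ) : ∑ q ∈ range (n + 1), 1 / √(q : ℝ) ≤ 2 * √(n : ℝ) := by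
  induction n with
  | zero => simp
  | succ n ih =>
    rw [sum_range_succ]
    have h1 : (0 : ℝ) < √((n + 1 : ℕ) : ℝ) := Real.sqrt_pos.2 (by positivity)
    have h2 : √(n : ℝ) * √((n + 1 : ℕ) : ℝ) ≤ (n : ℝ) + 1 / 2 := by
      rw [← Real.sqrt_mul (by positivity)]
      refine Real.sqrt_le_iff.2 ⟨by positivity, ?_⟩
      push_cast; nlinarith
    have h3 : √((n + 1 : ℕ) : ℝ) * √((n + 1 : ℕ) : ℝ) = n + 1 := by
      rw [Real.mul_self_sqrt (by positivity)]; push_cast; ring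
    have h4 : 1 / √((n + 1 : ℕ) : ℝ) ≤ 2 * √((n + 1 : ℕ) : ℝ) - 2 * √(n : ℝ) := by
      rw [div_le_iff₀ h1]; nlinarith
    linarith

/-- The mean value over `m` of the sums over `n`, by Weyl differencing. -/
lemma exists_sum_norm_sum_le {γ : ℝ} (hγ0 : 1 / 2 < γ) (hγ1 : γ < 1) : ∃ C : ℝ, 0 ≤ C ∧
    ∀ (β ξ h M N K T F : ℝ), 0 < h → 1 ≤ M → 1 ≤ N → F = h * (M * N) ^ γ →
    1 ≤ K → 1 ≤ T → 3 + 2 * Real.log (2 * M + 1) ≤ T → K ^ 4 ≤ F → F ≤ M * N * T →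
    K ^ 4 * T ≤ N → K ^ 18 * T ^ 4 ≤ (M * N) ^ 2 →
    ∑ m ∈ dyN M, ‖∑ n ∈ dyN N, e (β * m * n + ξ * n + h * ((m : ℝ) * n) ^ γ)‖ ≤
      C * (M * N * T / K) := by
  obtain ⟨C₀, hC₀, hdiff⟩ := exists_differenced_le hγ0 hγ1
  have hγ : 0 < γ := by linarith
  set C₁ : ℝ := 32 + 8 * C₀ + 16 * C₀ / √γ with hC₁
  have hC₁0 : 0 ≤ C₁ := by positivity
  refine ⟨√(2 * C₁), Real.sqrt_nonneg _, ?_⟩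
  intro β ξ h M N K T F hh hM hN hF hK hT hlog hKF hFT hKN hKY
  have hN0 : 0 < N := by linarith
  have hM0 : 0 < M := by linarith
  have hK0 : 0 < K := by linarith
  have hT0 : 0 < T := by linarith
  have hF0 : 0 < F := by rw [hF]; positivity
  set Y : ℝ := M * N with hY
  have hY0 : 0 < Y := by positivity
  set G : ℝ := F / N with hG
  have hG0 : 0 < G := by positivity
  set x : ℝ := max (K ^ 2) (K ^ 4 / G) with hx
  have hxK : K ^ 2 ≤ x := le_max_left _ _
  have hxG : K ^ 4 / G ≤ x := le_max_right _ _
  have hx1 : 1 ≤ x := (one_le_pow₀ hK).trans hxK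
  have hxN : x ≤ N := by
    refine max_le ?_ ?_
    · calc K ^ 2 ≤ K ^ 4 := pow_le_pow_right₀ hK (by norm_num)
        _ ≤ K ^ 4 * T := le_mul_of_one_le_right (by positivity) hT
        _ ≤ N := hKN
    · rw [hG, div_div_eq_mul_div, div_le_iff₀ hF0, mul_comm]; gcongr
  set Q : ℕ := ⌈x⌉₊ with hQ
  have hxQ : x ≤ Q := Nat.le_ceil _
  have hQ1 : (1 : ℝ) ≤ Q := hx1.trans hxQ
  have hQ0 : 0 < Q := by exact_mod_cast hQ1
  have hQN : (Q : ℝ) ≤ 2 * N := by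
    have := Nat.ceil_lt_add_one (a := x) (by linarith)
    linarith
  set A : ℕ := ⌈N / 2⌉₊ with hA
  set L : ℕ := ⌈N⌉₊ - A with hL
  have hLN : (L : ℝ) ≤ 2 * N := ceil_sub_ceil_half_le hN
  set z : ℕ → ℕ → ℂ := fun m j =>
    e (β * m * (A + j : ℕ) + ξ * (A + j : ℕ) + h * ((m : ℝ) * (A + j : ℕ)) ^ γ) with hz
  have hzsum : ∀ m : ℕ, ∑ n ∈ dyN N, e (β * m * n + ξ * n + h * ((m : ℝ) * n) ^ γ) =
      ∑ j ∈ range L, z m j := by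
    intro m
    rw [dyN_eq_Ico, sum_Ico_eq_sum_range]
  have hzmul : ∀ (q m j : ℕ), z m (j + q) * starRingEnd ℂ (z m j) = e (ξ * q) *
      e (β * q * m + h * (m : ℝ) ^ γ * (((A : ℝ) + j + q) ^ γ - ((A : ℝ) + j) ^ γ)) := by
    intro q m j
    simp only [hz]
    rw [← e_sub, ← e_add]
    congr 1
    push_cast
    rw [Real.mul_rpow (by positivity) (by positivity), Real.mul_rpow (by positivity) (by positivity)]
    rw [← add_assoc]
    ring
  have hq : ∀ q ∈ range Q, ‖∑ m ∈ dyN M, ∑ j ∈ range (L - q), z m (j + q) * starRingEnd ℂ (z m j)‖ ≤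
      (if q = 0 then 4 * Y else 0) + C₀ * T * (Y / K ^ 2 + Y / √(γ * G) * (1 / √(q : ℝ))) := by
    intro q hq
    rcases Nat.eq_zero_or_pos q with rfl | hq0
    · rw [if_pos rfl]
      have h1 : ‖∑ m ∈ dyN M, ∑ j ∈ range (L - 0), z m (j + 0) * starRingEnd ℂ (z m j)‖ ≤ 4 * Y := by
        refine (norm_sum_le _ _).trans ?_
        calc _ ≤ ∑ m ∈ dyN M, (L : ℝ) := by
              refine sum_le_sum fun m _ => (norm_sum_le _ _).trans ?_
              simp [hz, norm_e]
          _ = (dyN M).card * L := by rw [sum_const, nsmul_eq_mul]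
          _ ≤ 2 * M * (2 * N) := by
              have := card_dyN_le hM
              gcongr
          _ = 4 * Y := by rw [hY]; ring
      have h2 : 0 ≤ C₀ * T * (Y / K ^ 2 + Y / √(γ * G) * (1 / √((0 : ℕ) : ℝ))) := by positivity
      linarith
    · rw [if_neg hq0.ne', zero_add]
      have hq' : (q : ℝ) < x := Nat.lt_ceil.1 (mem_range.1 hq)
      have hqr : (0 : ℝ) < q := by exact_mod_cast hq0
      have hFq : γ * G * q = h * (γ * q * N ^ (γ - 1)) * M ^ γ := by
        rw [hG, hF, hY, Real.mul_rpow hM0.le hN0.le, Real.rpow_sub hN0, Real.rpow_one]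
        ring
      have hFqle : γ * G * q ≤ K ^ 2 * M * T + K ^ 4 := by
        calc γ * G * q ≤ 1 * G * x := by gcongr
          _ ≤ G * (K ^ 2 + K ^ 4 / G) := by
              rw [one_mul]; gcongr; exact max_le_add_of_nonneg (by positivity) (by positivity)
          _ = K ^ 2 * (F / N) + K ^ 4 := by rw [mul_add, mul_div_cancel₀ _ hG0.ne']; ring
          _ ≤ K ^ 2 * (M * T) + K ^ 4 := by
              gcongr
              rw [div_le_iff₀ hN0]; linarith
          _ = _ := by ring
      have key := hdiff (β * q) h M N A q (γ * G * q) K T (L - q) hh hM hN hqr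
        (le_trans (by exact_mod_cast Nat.sub_le _ _) hLN)
        (fun j hj => by
          have h1 : N / 2 ≤ A := Nat.le_ceil _
          have h2 : ((A + j + q : ℕ) : ℝ) < N := Nat.lt_ceil.1 (by omega)
          push_cast at h2
          exact ⟨by linarith [j.cast_nonneg (α := ℝ)], h2.le⟩) hFq hK hT hlog hKN hKY hFqle
      simp only [hzmul, ← mul_sum]
      rw [norm_mul, norm_e, one_mul]
      refine key.trans (le_of_eq ?_)
      rw [Real.sqrt_mul (by positivity) (q : ℝ)]
      ring
  have hsum : ∑ m ∈ dyN M, ‖∑ j ∈ range L, z m j‖ ^ 2 ≤ C₁ * (T * Y * N / K ^ 2) := by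
    refine (sum_norm_sq_sum_le (dyN M) z L Q hQ0).trans ?_
    have hs1 : ∑ q ∈ range Q, 1 / √(q : ℝ) ≤ 2 * √(Q : ℝ) := by
      refine le_trans ?_ (sum_range_inv_sqrt_le Q)
      rw [sum_range_succ]
      exact le_add_of_nonneg_right (by positivity)
    have hs2 : ∑ q ∈ range Q, ((if q = 0 then 4 * Y else 0) +
        C₀ * T * (Y / K ^ 2 + Y / √(γ * G) * (1 / √(q : ℝ)))) ≤
        4 * Y + C₀ * T * (Q * (Y / K ^ 2) + Y / √(γ * G) * (2 * √(Q : ℝ))) := by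
      rw [sum_add_distrib, ← mul_sum, sum_add_distrib, ← mul_sum, sum_const, card_range,
        nsmul_eq_mul, sum_ite_eq' (range Q) 0, if_pos (mem_range.2 hQ0)]
      gcongr
    have hQG : K ^ 2 ≤ √G * √(Q : ℝ) := by
      rw [← Real.sqrt_mul hG0.le]
      refine Real.le_sqrt_of_sq_le ?_
      calc (K ^ 2) ^ 2 = G * (K ^ 4 / G) := by field_simp
        _ ≤ _ := by gcongr; exact hxG.trans hxQ
    have hsG : 0 < √G := Real.sqrt_pos.2 hG0
    have hsQ : 0 < √(Q : ℝ) := Real.sqrt_pos.2 (by linarith)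
    have hsγ : 0 < √γ := Real.sqrt_pos.2 hγ
    have hsQ2 : √(Q : ℝ) / Q = 1 / √(Q : ℝ) := Real.sqrt_div_self'
    calc 2 * ((L : ℝ) + Q) / Q * ∑ q ∈ range Q, _ ≤ 2 * (2 * N + 2 * N) / Q *
          (4 * Y + C₀ * T * (Q * (Y / K ^ 2) + Y / √(γ * G) * (2 * √(Q : ℝ)))) := by
          gcongr
          exact (sum_le_sum hq).trans hs2
      _ = 32 * N * Y / Q + 8 * C₀ * (T * N * Y) / K ^ 2 +
          16 * C₀ / √γ * (T * N * Y) / √G * (√(Q : ℝ) / Q) := by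
          rw [Real.sqrt_mul hγ.le]
          field_simp
          ring
      _ = 32 * N * Y / Q + 8 * C₀ * (T * N * Y) / K ^ 2 +
          16 * C₀ / √γ * (T * N * Y) / (√G * √(Q : ℝ)) := by
          rw [hsQ2]; field_simp
      _ ≤ 32 * (T * N * Y) / K ^ 2 + 8 * C₀ * (T * N * Y) / K ^ 2 +
          16 * C₀ / √γ * (T * N * Y) / K ^ 2 := by
          have h1 : K ^ 2 ≤ Q := hxK.trans hxQ
          have h2 : 32 * N * Y ≤ 32 * (T * N * Y) := by
            calc 32 * N * Y = 32 * (1 * N * Y) := by ring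
              _ ≤ _ := by gcongr
          gcongr
      _ = _ := by rw [hC₁]; ring
  have hcs := sq_sum_le_card_mul_sum_sq (s := dyN M) (f := fun m => ‖∑ j ∈ range L, z m j‖)
  simp only [hzsum]
  refine le_of_sq_le_sq ?_ (by positivity)
  calc _ ≤ ((dyN M).card : ℝ) * ∑ m ∈ dyN M, ‖∑ j ∈ range L, z m j‖ ^ 2 := hcs
    _ ≤ 2 * M * (C₁ * (T * Y * N / K ^ 2)) := by
        have := card_dyN_le hM
        gcongr
    _ = 2 * C₁ * (Y ^ 2 * (T * 1) / K ^ 2) := by rw [hY]; ring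
    _ ≤ 2 * C₁ * (Y ^ 2 * (T * T) / K ^ 2) := by gcongr
    _ = (√(2 * C₁) * (Y * T / K)) ^ 2 := by
        have h1 : √(2 * C₁) ^ 2 = 2 * C₁ := Real.sq_sqrt (by positivity)
        rw [mul_pow (√(2 * C₁)), h1]; ring

lemma filter_dyN_eq_Ico (N X : ℝ) {m : ℕ} (hm : 0 < m) :
    (dyN N).filter (fun n => X / 2 ≤ ((m * n : ℕ) : ℝ) ∧ ((m * n : ℕ) : ℝ) < X) =
      Ico (max ⌈N / 2⌉₊ ⌈X / 2 / m⌉₊) (min ⌈N⌉₊ ⌈X / m⌉₊) := by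
  have hm' : (0 : ℝ) < m := by exact_mod_cast hm
  ext n
  rw [mem_filter, mem_dyN, mem_Ico, max_le_iff, lt_min_iff, Nat.ceil_le, Nat.ceil_le, Nat.lt_ceil,
    Nat.lt_ceil, div_le_iff₀ hm', lt_div_iff₀ hm', Nat.cast_mul, mul_comm (m : ℝ)]
  tauto

lemma pos_of_mem_dyN {M : ℝ} (hM : 1 ≤ M) {m : ℕ} (hm : m ∈ dyN M) : 0 < m := by
  have h : (0 : ℝ) < m := by linarith [(mem_dyN.1 hm).1]
  exact_mod_cast h

/-- The mean value over `m` of the sums over `n` restricted by `X / 2 ≤ m * n < X`. -/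
lemma exists_sum_norm_sum_filter_le {γ : ℝ} (hγ0 : 1 / 2 < γ) (hγ1 : γ < 1) : ∃ C : ℝ, 0 ≤ C ∧
    ∀ (β h M N K T F X : ℝ), h ≠ 0 → 1 ≤ M → 1 ≤ N → F = |h| * (M * N) ^ γ →
    1 ≤ K → 1 ≤ T → 3 + 2 * Real.log (2 * M + 1) ≤ T → 3 + 2 * Real.log (N + 1) ≤ T →
    K ^ 4 ≤ F → F ≤ M * N * T → K ^ 4 * T ≤ N → K ^ 18 * T ^ 4 ≤ (M * N) ^ 2 →
    ∑ m ∈ dyN M, ‖∑ n ∈ (dyN N).filter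
        (fun n => X / 2 ≤ ((m * n : ℕ) : ℝ) ∧ ((m * n : ℕ) : ℝ) < X),
      e (β * m * n + h * ((m : ℝ) * n) ^ γ)‖ ≤ C * (M * N * T ^ 2 / K) := by
  obtain ⟨C, hC, hmain⟩ := exists_sum_norm_sum_le hγ0 hγ1
  refine ⟨C, hC, ?_⟩
  intro β h M N K T F X hh hM hN hF hK hT hlogM hlogN hKF hFT hKN hKY
  wlog hpos : 0 < h generalizing β h
  · have hneg : 0 < -h := by
      have := lt_of_le_of_ne (not_lt.1 hpos) hh
      linarith
    refine le_trans (le_of_eq ?_) (this (-β) (-h) hneg.ne' (by rwa [abs_neg]) hneg)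
    refine sum_congr rfl fun m _ => ?_
    rw [← norm_sum_e_neg]
    congr 1
    refine sum_congr rfl fun n _ => ?_
    congr 1; ring
  rw [abs_of_pos hpos] at hF
  have hN0 : 0 < N := by linarith
  have hM0 : 0 < M := by linarith
  have hT0 : 0 < T := by linarith
  have hK0 : 0 < K := by linarith
  set P : ℕ := ⌈N⌉₊ with hP
  have hP0 : 0 < P := Nat.ceil_pos.2 hN0
  calc _ ≤ ∑ m ∈ dyN M, ∑ k ∈ range P, completionWeight P k *
        ‖∑ n ∈ dyN N, e (β * m * n + k / P * n + h * ((m : ℝ) * n) ^ γ)‖ := by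
        refine sum_le_sum fun m hm => ?_
        rw [filter_dyN_eq_Ico N X (pos_of_mem_dyN hM hm), dyN_eq_Ico]
        refine (norm_sum_Ico_le_completion _ hP0 (le_max_left _ _) (min_le_left _ _)
          (by omega : P ≤ ⌈N / 2⌉₊ + P)).trans (le_of_eq ?_)
        refine sum_congr rfl fun k _ => ?_
        congr 2
        refine sum_congr rfl fun n _ => ?_
        rw [← e_add]; congr 1; ring
    _ = ∑ k ∈ range P, completionWeight P k *
        ∑ m ∈ dyN M, ‖∑ n ∈ dyN N, e (β * m * n + k / P * n + h * ((m : ℝ) * n) ^ γ)‖ := by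
        rw [sum_comm]; simp only [mul_sum]
    _ ≤ ∑ k ∈ range P, completionWeight P k * (C * (M * N * T / K)) := by
        refine sum_le_sum fun k _ => mul_le_mul_of_nonneg_left ?_ (completionWeight_nonneg P k)
        exact hmain β (k / P) h M N K T F hpos hM hN hF hK hT hlogM hKF hFT hKN hKY
    _ ≤ T * (C * (M * N * T / K)) := by
        rw [← sum_mul]
        gcongr
        refine (sum_completionWeight_le hP0).trans (le_trans ?_ hlogN)
        have := Nat.ceil_lt_add_one hN0.le
        gcongr
    _ = _ := by ring

lemma mem_dyZ {Y : ℝ} {l : ℤ} (hl : l ∈ dyZ Y) : l ≠ 0 ∧ (|l| : ℝ) < Y := by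
  simp only [dyZ, mem_filter] at hl
  exact ⟨hl.2.1, by simpa using hl.2.2.2⟩

lemma card_dyZ_le {Y : ℝ} (hY : 1 ≤ Y) : ((dyZ Y).card : ℝ) ≤ 5 * Y := by
  have h1 : (dyZ Y).card ≤ 2 * ⌈Y⌉₊ + 1 := by
    refine (card_filter_le _ _).trans ?_
    rw [Int.card_Icc]; omega
  have h2 := Nat.ceil_lt_add_one (a := Y) (by linarith)
  have h3 : ((dyZ Y).card : ℝ) ≤ 2 * ⌈Y⌉₊ + 1 := by exact_mod_cast h1
  linarith

lemma norm_quadruple_sum_le (γ α : ℝ) (S : Finset ℕ) (R : ℕ → Finset ℕ) (A B : Finset ℤ)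
    (a : ℕ → ℂ) (c d : ℤ → ℂ) (ha : ∀ m ∈ S, ‖a m‖ ≤ 1) (hc : ∀ l ∈ A, ‖c l‖ ≤ 1)
    (hd : ∀ h ∈ B, ‖d h‖ ≤ 1) :
    ‖∑ m ∈ S, ∑ n ∈ R m, ∑ l ∈ A, ∑ h ∈ B, a m * c l * d h *
      e (α * (l : ℝ) * (m : ℝ) * (n : ℝ) + (h : ℝ) * ((m : ℝ) * (n : ℝ)) ^ γ)‖ ≤
    ∑ l ∈ A, ∑ h ∈ B, ∑ m ∈ S, ‖∑ n ∈ R m, e (α * l * m * n + h * ((m : ℝ) * n) ^ γ)‖ := by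
  have hswap : ∑ m ∈ S, ∑ n ∈ R m, ∑ l ∈ A, ∑ h ∈ B, a m * c l * d h *
      e (α * (l : ℝ) * (m : ℝ) * (n : ℝ) + (h : ℝ) * ((m : ℝ) * (n : ℝ)) ^ γ) =
      ∑ l ∈ A, ∑ h ∈ B, ∑ m ∈ S, a m * c l * d h *
        ∑ n ∈ R m, e (α * l * m * n + h * ((m : ℝ) * n) ^ γ) := by
    calc _ = ∑ m ∈ S, ∑ l ∈ A, ∑ h ∈ B, a m * c l * d h *
          ∑ n ∈ R m, e (α * l * m * n + h * ((m : ℝ) * n) ^ γ) := by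
          refine sum_congr rfl fun m _ => ?_
          rw [sum_comm]
          refine sum_congr rfl fun l _ => ?_
          rw [sum_comm]
          refine sum_congr rfl fun h _ => ?_
          rw [mul_sum]
      _ = ∑ l ∈ A, ∑ m ∈ S, ∑ h ∈ B, a m * c l * d h *
          ∑ n ∈ R m, e (α * l * m * n + h * ((m : ℝ) * n) ^ γ) := sum_comm
      _ = _ := sum_congr rfl fun l _ => sum_comm
  rw [hswap]
  refine (norm_sum_le _ _).trans (sum_le_sum fun l hl => (norm_sum_le _ _).trans
    (sum_le_sum fun h hh => (norm_sum_le _ _).trans (sum_le_sum fun m hm => ?_)))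
  rw [norm_mul, norm_mul, norm_mul]
  refine mul_le_of_le_one_left (norm_nonneg _) ?_
  exact mul_le_one₀ (mul_le_one₀ (ha m hm) (norm_nonneg _) (hc l hl)) (norm_nonneg _) (hd h hh)

lemma three_add_two_log_le {η x y : ℝ} (hη : 0 < η) (hx : 1 ≤ x) (hy : 1 ≤ y) (hyx : y ≤ 9 * x)
    (hxη : 3 + 2 * Real.log 9 + 2 / η ≤ x ^ η) : 3 + 2 * Real.log y ≤ x ^ (2 * η) := by
  have h1 : Real.log y ≤ Real.log 9 + Real.log x := by
    rw [← Real.log_mul (by norm_num) (by linarith)]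
    exact Real.log_le_log (by linarith) hyx
  have h2 := Real.log_le_rpow_div (by linarith : 0 ≤ x) hη
  have h3 : 1 ≤ x ^ η := Real.one_le_rpow hx hη.le
  have h4 : x ^ (2 * η) = x ^ η * x ^ η := by
    rw [← Real.rpow_add (by linarith)]; ring_nf
  have h5 : 0 ≤ Real.log 9 := Real.log_nonneg (by norm_num)
  calc 3 + 2 * Real.log y ≤ (3 + 2 * Real.log 9) * 1 + 2 * (x ^ η / η) := by linarith
    _ ≤ (3 + 2 * Real.log 9) * x ^ η + 2 * (x ^ η / η) := by gcongr
    _ = (3 + 2 * Real.log 9 + 2 / η) * x ^ η := by ring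
    _ ≤ x ^ η * x ^ η := by gcongr
    _ = _ := h4.symm

theorem S3_medium (c γ θ : ℝ) (hc1 : 1 < c) (hc2 : c < 9/8) (hγ : γ = 1/c)
    (hθ1 : 0 < θ) (hθ2 : θ < (9*γ - 8)/10) :
    ∃ ε > (0:ℝ), ∃ η > (0:ℝ), ∃ C > (0:ℝ), ∃ X₀ > (0:ℝ), ∀ X : ℕ, X₀ ≤ (X:ℝ) → ∀ α : ℝ,
    ∀ M N U V : ℝ, 1 ≤ M → 1 ≤ N → 1 ≤ U → 1 ≤ V →
    (X:ℝ)^(7-8*γ+8*θ+8*ε+40*η) ≤ M → M ≤ (X:ℝ)^(4*γ-3-4*θ-4*ε-20*η) → U ≤ (⌊(X:ℝ)^(θ+η)⌋₊ : ℝ) → V ≤ (⌊10 * (X:ℝ)^(1-γ+η) / γ⌋₊ : ℝ) →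
    ∀ am : ℕ → ℂ, ∀ cl dh : ℤ → ℂ, (∀ m ∈ dyN M, ‖am m‖ ≤ 1) → (∀ l ∈ dyZ U, ‖cl l‖ ≤ 1) → (∀ h ∈ dyZ V, ‖dh h‖ ≤ 1) →
    ‖∑ m ∈ dyN M, ∑ n ∈ (dyN N).filter (fun n => (X:ℝ)/2 ≤ ((m*n:ℕ):ℝ) ∧ ((m*n:ℕ):ℝ) < (X:ℝ)),
        ∑ l ∈ dyZ U, ∑ h ∈ dyZ V, am m * cl l * dh h * e (α * (l:ℝ) * (m:ℝ) * (n:ℝ) + (h:ℝ) * ((m:ℝ)*(n:ℝ))^γ)‖ ≤ C * (X:ℝ)^(1-2*η) := by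
  have hγ1 : γ < 1 := by rw [hγ, div_lt_one (by linarith)]; exact hc1
  have hγ89 : 8 / 9 < γ := by
    rw [hγ, lt_div_iff₀ (by linarith)]; linarith
  have hγ0 : 0 < γ := by linarith
  obtain ⟨C, hC, hmain⟩ := exists_sum_norm_sum_filter_le (γ := γ) (by linarith) hγ1
  obtain ⟨η, hηdef⟩ : ∃ η, η = (γ - 8 / 9 - θ) / 20 := ⟨_, rfl⟩
  have hη : 0 < η := by rw [hηdef]; linarith
  set D : ℝ := 4 + 20 / γ + (3 + 2 * Real.log 9 + 2 / η) with hD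
  have hlog9 : 0 ≤ Real.log 9 := Real.log_nonneg (by norm_num)
  have hD4 : 4 ≤ D := by
    have : 0 ≤ 20 / γ + (3 + 2 * Real.log 9 + 2 / η) := by positivity
    linarith
  refine ⟨10 * η, by linarith, η, hη, 1000 / γ * C + 1, by positivity, D ^ (1 / η), by positivity, ?_⟩
  intro X hX α M N U V hM hN hU hV _ hMX hUX hVX am cl dh ham hcl hdh
  obtain ⟨x, hx⟩ : ∃ x : ℝ, x = X := ⟨_, rfl⟩
  rw [← hx] at hX hMX hUX hVX ⊢
  have hx1 : 1 ≤ x := (Real.one_le_rpow (by linarith) (by positivity)).trans hX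
  have hx0 : 0 < x := by linarith
  have hxD : D ≤ x ^ η := by
    calc D = (D ^ (1 / η)) ^ η := by
          rw [← Real.rpow_mul (by linarith), one_div_mul_cancel hη.ne', Real.rpow_one]
      _ ≤ x ^ η := by gcongr
  have hx4 : 4 ≤ x ^ η := hD4.trans hxD
  have hxγ : 20 / γ ≤ x ^ η := by
    refine le_trans ?_ hxD
    have : 0 ≤ 4 + (3 + 2 * Real.log 9 + 2 / η) := by positivity
    linarith
  have hxlog : 3 + 2 * Real.log 9 + 2 / η ≤ x ^ η := by
    refine le_trans ?_ hxD
    have : 0 ≤ 4 + 20 / γ := by positivity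
    linarith
  have hmono : ∀ {a b : ℝ}, a ≤ b → x ^ a ≤ x ^ b :=
    fun h => Real.rpow_le_rpow_of_exponent_le hx1 h
  have hpow : ∀ (a : ℝ) (n : ℕ), (x ^ a) ^ n = x ^ (a * n) := fun a n => by
    rw [Real.rpow_mul hx0.le, Real.rpow_natCast]
  by_cases hex : ∃ m ∈ dyN M, ∃ n ∈ dyN N, x / 2 ≤ ((m * n : ℕ) : ℝ) ∧ ((m * n : ℕ) : ℝ) < x
  swap
  · rw [sum_eq_zero]
    · rw [norm_zero]; positivity
    · intro m hm
      rw [filter_eq_empty_iff.2, sum_empty]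
      exact fun n hn h => hex ⟨m, hm, n, hn, h⟩
  obtain ⟨m₀, hm₀, n₀, hn₀, hmn1, hmn2⟩ := hex
  obtain ⟨hm1, hm2⟩ := mem_dyN.1 hm₀
  obtain ⟨hn1, hn2⟩ := mem_dyN.1 hn₀
  push_cast at hmn1 hmn2
  have hM0 : 0 < M := by linarith
  have hN0 : 0 < N := by linarith
  have hY1 : x / 2 ≤ M * N := by
    refine hmn1.trans ?_
    gcongr
  have hY2 : M * N ≤ 4 * x := by
    have : M / 2 * (N / 2) ≤ m₀ * n₀ := by gcongr
    linarith
  set κ : ℝ := 1 / 9 - 10 * η with hκ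
  have hθη : θ = γ - 8 / 9 - 20 * η := by rw [hηdef]; ring
  have hη180 : η ≤ 1 / 180 := by rw [hηdef]; linarith
  have hMx : M ≤ x := by
    refine hMX.trans ((hmono ?_).trans (Real.rpow_one x).le)
    linarith
  have hNx : N ≤ 4 * x := le_trans (le_mul_of_one_le_left hN0.le hM) hY2
  have hT1 : 1 ≤ x ^ (2 * η) := Real.one_le_rpow hx1 (by linarith)
  have hK1 : 1 ≤ x ^ κ := Real.one_le_rpow hx1 (by rw [hκ]; linarith)
  have hlogM : 3 + 2 * Real.log (2 * M + 1) ≤ x ^ (2 * η) :=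
    three_add_two_log_le hη hx1 (by linarith) (by linarith) hxlog
  have hlogN : 3 + 2 * Real.log (N + 1) ≤ x ^ (2 * η) :=
    three_add_two_log_le hη hx1 (by linarith) (by linarith) hxlog
  have hKN : (x ^ κ) ^ 4 * x ^ (2 * η) ≤ N := by
    have h1 : (x ^ κ) ^ 4 * x ^ (2 * η) * (2 * x ^ (4*γ-3-4*θ-4*(10*η)-20*η)) ≤ x := by
      calc _ ≤ (x ^ κ) ^ 4 * x ^ (2 * η) * (x ^ η * x ^ (4*γ-3-4*θ-4*(10*η)-20*η)) := by
            gcongr; linarith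
        _ = x ^ (1 - 17 * η) := by
            rw [hpow, ← Real.rpow_add hx0, ← Real.rpow_add hx0, ← Real.rpow_add hx0, hκ, hθη]
            congr 1; push_cast; ring
        _ ≤ x := (hmono (by linarith)).trans (Real.rpow_one x).le
    have h2 : (x ^ κ) ^ 4 * x ^ (2 * η) * (2 * M) ≤ N * (2 * M) := by
      calc _ ≤ (x ^ κ) ^ 4 * x ^ (2 * η) * (2 * x ^ (4*γ-3-4*θ-4*(10*η)-20*η)) := by gcongr
        _ ≤ N * (2 * M) := by linarith
    exact le_of_mul_le_mul_right h2 (by positivity)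
  have hKY : (x ^ κ) ^ 18 * (x ^ (2 * η)) ^ 4 ≤ (M * N) ^ 2 := by
    have h1 : (x ^ κ) ^ 18 * (x ^ (2 * η)) ^ 4 * 4 ≤ x ^ 2 := by
      calc _ ≤ (x ^ κ) ^ 18 * (x ^ (2 * η)) ^ 4 * x ^ η := by gcongr
        _ = x ^ (2 - 171 * η) := by
            rw [hpow, hpow, ← Real.rpow_add hx0, ← Real.rpow_add hx0, hκ]
            congr 1; push_cast; ring
        _ ≤ x ^ (2 : ℝ) := hmono (by linarith)
        _ = x ^ 2 := Real.rpow_two x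
    calc _ ≤ (x / 2) ^ 2 := by linarith
      _ ≤ _ := by gcongr
  have hUx : U ≤ x ^ (θ + η) := hUX.trans (Nat.floor_le (by positivity))
  have hVx : V ≤ 10 * x ^ (1 - γ + η) / γ := hVX.trans (Nat.floor_le (by positivity))
  have hYγ1 : x ^ γ / 2 ≤ (M * N) ^ γ := by
    calc x ^ γ / 2 = x ^ γ / 2 ^ (1 : ℝ) := by rw [Real.rpow_one]
      _ ≤ x ^ γ / 2 ^ γ := by
          gcongr
          · norm_num
      _ = (x / 2) ^ γ := (Real.div_rpow hx0.le (by norm_num) _).symm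
      _ ≤ _ := by gcongr
  have hYγ2 : (M * N) ^ γ ≤ 2 * x ^ (γ - 1) * (M * N) := by
    calc (M * N) ^ γ = (M * N) ^ (γ - 1) * (M * N) := by
          rw [Real.rpow_sub (by positivity), Real.rpow_one, div_mul_cancel₀ _ (by positivity)]
      _ ≤ (x / 2) ^ (γ - 1) * (M * N) := by
          gcongr ?_ * _
          exact Real.rpow_le_rpow_of_nonpos (by positivity) hY1 (by linarith)
      _ = x ^ (γ - 1) * 2 ^ (1 - γ) * (M * N) := by
          rw [Real.div_rpow hx0.le (by norm_num), show γ - 1 = -(1 - γ) by ring,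
            Real.rpow_neg (by norm_num : (0 : ℝ) ≤ 2), div_inv_eq_mul]
      _ ≤ x ^ (γ - 1) * 2 ^ (1 : ℝ) * (M * N) := by
          gcongr
          · norm_num
          · linarith
      _ = _ := by rw [Real.rpow_one]; ring
  set B : ℝ := C * (M * N * (x ^ (2 * η)) ^ 2 / x ^ κ) with hB
  have hB0 : 0 ≤ B := by positivity
  have hterm : ∀ l ∈ dyZ U, ∀ h ∈ dyZ V, ∑ m ∈ dyN M, ‖∑ n ∈ (dyN N).filter
      (fun n => x / 2 ≤ ((m * n : ℕ) : ℝ) ∧ ((m * n : ℕ) : ℝ) < x),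
      e (α * l * m * n + h * ((m : ℝ) * n) ^ γ)‖ ≤ B := by
    intro l _ h hh
    obtain ⟨hh0, hhV⟩ := mem_dyZ hh
    have hh1 : (1 : ℝ) ≤ |(h : ℝ)| := by exact_mod_cast Int.one_le_abs hh0
    refine hmain (α * l) h M N (x ^ κ) (x ^ (2 * η)) _ x (by exact_mod_cast hh0) hM hN rfl hK1 hT1
      hlogM hlogN ?_ ?_ hKN hKY
    · have h1 : (x ^ κ) ^ 4 * 2 ≤ x ^ γ := by
        calc (x ^ κ) ^ 4 * 2 ≤ (x ^ κ) ^ 4 * x ^ η := by gcongr; linarith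
          _ = x ^ (4 / 9 - 39 * η) := by
              rw [hpow, ← Real.rpow_add hx0, hκ]; congr 1; push_cast; ring
          _ ≤ x ^ γ := hmono (by linarith)
      calc (x ^ κ) ^ 4 ≤ 1 * (x ^ γ / 2) := by linarith
        _ ≤ _ := by gcongr
    · calc |(h : ℝ)| * (M * N) ^ γ ≤
            10 * x ^ (1 - γ + η) / γ * (2 * x ^ (γ - 1) * (M * N)) := by
            gcongr; exact hhV.le.trans hVx
        _ = 20 / γ * (M * N) * (x ^ (1 - γ + η) * x ^ (γ - 1)) := by ring
        _ = 20 / γ * (M * N) * x ^ η := by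
            rw [← Real.rpow_add hx0]; congr 2; ring
        _ ≤ x ^ η * (M * N) * x ^ η := by gcongr
        _ = M * N * (x ^ η * x ^ η) := by ring
        _ = _ := by rw [← Real.rpow_add hx0, two_mul]
  refine (norm_quadruple_sum_le γ α _ _ _ _ am cl dh ham hcl hdh).trans ?_
  calc _ ≤ ∑ l ∈ dyZ U, ∑ h ∈ dyZ V, B :=
        sum_le_sum fun l hl => sum_le_sum fun h hh => hterm l hl h hh
    _ = (dyZ U).card * ((dyZ V).card * B) := by simp only [sum_const, nsmul_eq_mul]
    _ ≤ 5 * x ^ (θ + η) * (5 * (10 * x ^ (1 - γ + η) / γ) *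
          (C * (4 * x * (x ^ (2 * η)) ^ 2 / x ^ κ))) := by
        have h1 : ((dyZ U).card : ℝ) ≤ 5 * x ^ (θ + η) := (card_dyZ_le hU).trans (by linarith)
        have h2 : ((dyZ V).card : ℝ) ≤ 5 * (10 * x ^ (1 - γ + η) / γ) :=
          (card_dyZ_le hV).trans (by linarith)
        have h3 : B ≤ C * (4 * x * (x ^ (2 * η)) ^ 2 / x ^ κ) := by
          rw [hB]; gcongr
        exact mul_le_mul h1 (mul_le_mul h2 h3 hB0 (by positivity))
          (mul_nonneg (Nat.cast_nonneg _) hB0) (by positivity)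
    _ = 1000 / γ * C * (x ^ (θ + η) * x ^ (1 - γ + η) * x ^ (1 : ℝ) * (x ^ (2 * η)) ^ 2 / x ^ κ) := by
        rw [Real.rpow_one]; ring
    _ = 1000 / γ * C * x ^ (1 - 4 * η) := by
        rw [hpow, ← Real.rpow_add hx0, ← Real.rpow_add hx0, ← Real.rpow_add hx0,
          ← Real.rpow_sub hx0, hκ, hθη]
        congr 2; push_cast; ring
    _ ≤ (1000 / γ * C + 1) * x ^ (1 - 2 * η) :=
        mul_le_mul (by linarith) (hmono (by linarith)) (by positivity) (by positivity)
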